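/- arXiv:1406.6335 — 2 statements merged into one kernel-verified Lean document; each statement's English description precedes it below -/
import Mathlib

section
/- Let E be a Riesz space with point separating order dual whose Arens homomorphism m : Z(E)'' → Z(E^~) is surjective. Then there exists an idempotent π ∈ Z(E)'' such that Ker(m) = (1−π)·Z(E)'' and Z(E^~) = m(π·Z(E)''), so that Z(E^~) can be identified with π·Z(E)''. -/
noncomputable section

open Set

/-- A map between preordered sets is *order bounded* if it maps order intervals into
order intervals. -/
def IsOrdBdd {E F : Type*} [Preorder E] [Preorder F] (f : E → F) : Prop :=
  ∀ a b : E, ∃ c d : F, ∀ x : E, a ≤ x → x ≤ b → c ≤ f x ∧ f x ≤ d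

/-- A map of a Riesz space is *band preserving* if it preserves disjointness. -/
def IsBandPres {E : Type*} [Lattice E] [AddCommGroup E] (T : E → E) : Prop :=
  ∀ x y : E, |x| ⊓ |y| = 0 → |T x| ⊓ |y| = 0

/-- An *orthomorphism*: an order bounded, band preserving linear map. -/
def IsOrtho {E : Type*} [Lattice E] [AddCommGroup E] [Module ℝ E] (T : E → E) : Prop :=
  IsLinearMap ℝ T ∧ IsOrdBdd T ∧ IsBandPres T

/-- A member of the *ideal center* `Z(E)`: an orthomorphism dominated by a multiple of the
identity. -/
def IsCentral {E : Type*} [Lattice E] [AddCommGroup E] [Module ℝ E] (T : E → E) : Prop :=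
  IsOrtho T ∧ ∃ c : ℝ, ∀ x : E, 0 ≤ x → -(c • x) ≤ T x ∧ T x ≤ c • x

/-- Order continuity of a real functional: it converges to `0` along every downward
directed system with infimum `0`. -/
def IsOrderContinuousFun {X : Type*} [Lattice X] [AddCommGroup X] (φ : X → ℝ) : Prop :=
  ∀ s : Set X, s.Nonempty → DirectedOn (· ≥ ·) s → IsGLB s 0 →
    ∀ ε : ℝ, 0 < ε → ∃ x ∈ s, ∀ y ∈ s, y ≤ x → |φ y| < ε

/-- `p` realizes the Riesz space `D` as the order dual `E^∼` of `E`. -/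
structure IsOrderDual (E D : Type*) [Lattice E] [AddCommGroup E] [Module ℝ E]
    [Lattice D] [AddCommGroup D] [Module ℝ D] (p : D → E → ℝ) : Prop where
  lin_fun : ∀ f : D, IsLinearMap ℝ (p f)
  lin_vec : ∀ x : E, IsLinearMap ℝ fun f => p f x
  bdd : ∀ f : D, IsOrdBdd (p f)
  inj : ∀ f g : D, (∀ x, p f x = p g x) → f = g
  surj : ∀ φ : E → ℝ, IsLinearMap ℝ φ → IsOrdBdd φ → ∃ f : D, ∀ x, p f x = φ x
  le_iff : ∀ f g : D, f ≤ g ↔ ∀ x : E, 0 ≤ x → p f x ≤ p g x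

/-- `p` realizes the Riesz space `B` as the order continuous order dual `(X^∼)ₙ` of `X`
(used for `X = A^∼`, giving `B = (A^∼)ₙ^∼`). -/
structure IsOrderContinuousDual (X B : Type*) [Lattice X] [AddCommGroup X] [Module ℝ X]
    [Lattice B] [AddCommGroup B] [Module ℝ B] (p : B → X → ℝ) : Prop where
  lin_fun : ∀ F : B, IsLinearMap ℝ (p F)
  lin_vec : ∀ f : X, IsLinearMap ℝ fun F => p F f
  bdd : ∀ F : B, IsOrdBdd (p F)
  cont : ∀ F : B, IsOrderContinuousFun (p F)
  inj : ∀ F G : B, (∀ f, p F f = p G f) → F = G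
  surj : ∀ φ : X → ℝ, IsLinearMap ℝ φ → IsOrdBdd φ → IsOrderContinuousFun φ →
    ∃ F : B, ∀ f, p F f = φ f
  le_iff : ∀ F G : B, F ≤ G ↔ ∀ f : X, 0 ≤ f → p F f ≤ p G f

/-- `ρ` realizes the lattice-ordered algebra `O` as the `f`-algebra `Orth(E)` of all
orthomorphisms of `E`. -/
structure IsOrthAlg (E O : Type*) [Lattice E] [AddCommGroup E] [Module ℝ E]
    [Lattice O] [Ring O] [Module ℝ O] (ρ : O → E → E) : Prop where
  ortho : ∀ a : O, IsOrtho (ρ a)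
  lin_vec : ∀ x : E, IsLinearMap ℝ fun a => ρ a x
  map_one : ∀ x : E, ρ 1 x = x
  map_mul : ∀ (a b : O) (x : E), ρ (a * b) x = ρ a (ρ b x)
  inj : ∀ a b : O, (∀ x, ρ a x = ρ b x) → a = b
  surj : ∀ T : E → E, IsOrtho T → ∃ a : O, ∀ x, ρ a x = T x
  le_iff : ∀ a b : O, a ≤ b ↔ ∀ x : E, 0 ≤ x → ρ a x ≤ ρ b x

/-- `ρ` realizes the normed lattice-ordered algebra `Z` as the ideal center `Z(E)` of `E`,
an AM-space whose norm is the order unit norm (the order/algebra unit being `id`). -/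
structure IsCenterOf (E Z : Type*) [Lattice E] [AddCommGroup E] [Module ℝ E]
    [Lattice Z] [NormedRing Z] [NormedAlgebra ℝ Z] (ρ : Z → E → E) : Prop where
  central : ∀ a : Z, IsCentral (ρ a)
  lin_vec : ∀ x : E, IsLinearMap ℝ fun a => ρ a x
  map_one : ∀ x : E, ρ 1 x = x
  map_mul : ∀ (a b : Z) (x : E), ρ (a * b) x = ρ a (ρ b x)
  inj : ∀ a b : Z, (∀ x, ρ a x = ρ b x) → a = b
  surj : ∀ T : E → E, IsCentral T → ∃ a : Z, ∀ x, ρ a x = T x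
  le_iff : ∀ a b : Z, a ≤ b ↔ ∀ x : E, 0 ≤ x → ρ a x ≤ ρ b x
  norm_le_iff : ∀ (a : Z) (c : ℝ), 0 ≤ c →
    (‖a‖ ≤ c ↔ ∀ x : E, 0 ≤ x → -(c • x) ≤ ρ a x ∧ ρ a x ≤ c • x)

/-- The pairing `p : D → E → ℝ` separates the points of `E`. -/
def SepPoints {E D : Type*} [Zero E] (p : D → E → ℝ) : Prop :=
  ∀ x : E, (∀ f : D, p f x = 0) → x = 0

/-- `y` belongs to the `σ(E,D)`-closure of `s ⊆ E`, for the pairing `p : D → E → ℝ`. -/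
def InWeakClosure {E D : Type*} (p : D → E → ℝ) (s : Set E) (y : E) : Prop :=
  ∀ (fs : Finset D) (ε : ℝ), 0 < ε → ∃ z ∈ s, ∀ f ∈ fs, |p f z - p f y| < ε

/-- `E` has a *topologically full center*: for each `x ∈ E₊` the `σ(E,E^∼)`-closure of
`Z(E)x` contains the order ideal generated by `x`.  Here `p : D → E → ℝ` is the duality
with `E^∼` and `ρ : Z → E → E` is the action of the ideal center. -/
def TopFullCenter {E D Z : Type*} [Lattice E] [AddCommGroup E] [Module ℝ E]
    (p : D → E → ℝ) (ρ : Z → E → E) : Prop :=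
  ∀ x : E, 0 ≤ x → ∀ y : E, (∃ c : ℝ, 0 ≤ c ∧ |y| ≤ c • x) →
    InWeakClosure p {z | ∃ T : Z, ρ T x = z} y

/-- `FG` is the Arens product `F ⬝ G` in the order bidual `B` of the algebra `A`:
`(F⬝G)(f) = F(G⬝f)`, `(G⬝f)(a) = G(f⬝a)`, `(f⬝a)(b) = f(ab)`; `pA : DA → A → ℝ` is the
duality of `A` with `A^∼` and `pB : B → DA → ℝ` that of `(A^∼)ₙ^∼` with `A^∼`. -/
def IsArensProduct {A DA B : Type*} [Mul A] (pA : DA → A → ℝ) (pB : B → DA → ℝ)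
    (F G FG : B) : Prop :=
  ∀ f Gf : DA,
    (∀ (a : A) (fa : DA), (∀ b : A, pA fa b = pA f (a * b)) → pA Gf a = pB G fa) →
    pB FG f = pB F Gf

/-- The ring structure of `B` is the Arens multiplication inherited from `A`, with unit the
canonical image of `1 ∈ A`. -/
structure IsArensAlgebra {A DA B : Type*} [Monoid A] [Ring B]
    (pA : DA → A → ℝ) (pB : B → DA → ℝ) : Prop where
  mul_def : ∀ F G : B, IsArensProduct pA pB F G (F * G)
  one_def : ∀ f : DA, pB 1 f = pA f 1

section NormedArens

variable (Z : Type*) [NormedRing Z] [NormedAlgebra ℝ Z]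

/-- First step of the Arens construction: `f ⬝ a` for `f ∈ Z'`, `a ∈ Z`:
`(f⬝a)(b) = f(ab)`. -/
def arensDot (f : Z →L[ℝ] ℝ) (a : Z) : Z →L[ℝ] ℝ :=
  f.comp (ContinuousLinearMap.mul ℝ Z a)

/-- `a ↦ f ⬝ a` as a continuous linear map. -/
def arensDotL (f : Z →L[ℝ] ℝ) : Z →L[ℝ] Z →L[ℝ] ℝ :=
  (ContinuousLinearMap.compL ℝ Z Z ℝ f).comp (ContinuousLinearMap.mul ℝ Z)

/-- Second step of the Arens construction: `F ⬝ f` for `F ∈ Z''`, `f ∈ Z'`: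
`(F⬝f)(a) = F(f⬝a)`. -/
def arensFDot (F : (Z →L[ℝ] ℝ) →L[ℝ] ℝ) (f : Z →L[ℝ] ℝ) : Z →L[ℝ] ℝ :=
  F.comp (arensDotL Z f)

/-- `f ↦ f ⬝ ·` as a continuous linear map. -/
def arensDotLL : (Z →L[ℝ] ℝ) →L[ℝ] Z →L[ℝ] Z →L[ℝ] ℝ :=
  ((ContinuousLinearMap.compL ℝ Z (Z →L[ℝ] Z) (Z →L[ℝ] ℝ)).flip
      (ContinuousLinearMap.mul ℝ Z)).comp (ContinuousLinearMap.compL ℝ Z Z ℝ)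

/-- `f ↦ F ⬝ f` as a continuous linear map. -/
def arensFDotL (F : (Z →L[ℝ] ℝ) →L[ℝ] ℝ) : (Z →L[ℝ] ℝ) →L[ℝ] Z →L[ℝ] ℝ :=
  (ContinuousLinearMap.compL ℝ Z (Z →L[ℝ] ℝ) ℝ F).comp (arensDotLL Z)

/-- The *Arens product* on the norm bidual `Z''`: `(F⬝G)(f) = F(G⬝f)`. -/
def arensMul (F G : (Z →L[ℝ] ℝ) →L[ℝ] ℝ) : (Z →L[ℝ] ℝ) →L[ℝ] ℝ :=
  F.comp (arensFDotL Z G)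

/-- The canonical image of `1 ∈ Z` in the bidual `Z''`; it is the unit for the Arens
product. -/
def arensOne : (Z →L[ℝ] ℝ) →L[ℝ] ℝ := ContinuousLinearMap.apply ℝ ℝ (1 : Z)

end NormedArens

section DualOrder

variable {Z : Type*} [Lattice Z] [NormedRing Z] [NormedAlgebra ℝ Z]

/-- Positivity of a functional in `Z'`. -/
def dualNonneg (μ : Z →L[ℝ] ℝ) : Prop := ∀ a : Z, 0 ≤ a → 0 ≤ μ a

/-- The canonical order of the bidual `Z''`. -/
def bidualLe (F G : (Z →L[ℝ] ℝ) →L[ℝ] ℝ) : Prop :=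
  ∀ μ : Z →L[ℝ] ℝ, dualNonneg μ → F μ ≤ G μ

/-- `H = F ⊔ G` in the bidual `Z''`. -/
def IsBidualSup (F G H : (Z →L[ℝ] ℝ) →L[ℝ] ℝ) : Prop :=
  bidualLe F H ∧ bidualLe G H ∧
    ∀ K : (Z →L[ℝ] ℝ) →L[ℝ] ℝ, bidualLe F K → bidualLe G K → bidualLe H K

/-- `s ⊆ Z''` is downward directed with infimum `0`. -/
def BidualDownTo0 (s : Set ((Z →L[ℝ] ℝ) →L[ℝ] ℝ)) : Prop :=
  s.Nonempty ∧ (∀ F ∈ s, ∀ G ∈ s, ∃ H ∈ s, bidualLe H F ∧ bidualLe H G) ∧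
    (∀ F ∈ s, bidualLe 0 F) ∧ ∀ K, (∀ F ∈ s, bidualLe K F) → bidualLe K 0

/-- The Riesz–Kantorovich formula for `|μ|(a)`, `μ ∈ Z'`, `a ∈ Z₊`. -/
def dualAbs (μ : Z →L[ℝ] ℝ) (a : Z) : ℝ := sSup ((fun b => μ b) '' {b : Z | |b| ≤ a})

/-- Disjointness `|μ| ⊓ |ν| = 0` in `Z'`. -/
def DualDisjoint (μ ν : Z →L[ℝ] ℝ) : Prop :=
  ∀ a : Z, 0 ≤ a → ∀ ε : ℝ, 0 < ε →
    ∃ b c : Z, 0 ≤ b ∧ 0 ≤ c ∧ b + c = a ∧ dualAbs μ b + dualAbs ν c < ε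

/-- The Riesz–Kantorovich formula for `|F|(μ)`, `F ∈ Z''`, `μ ∈ Z'₊`. -/
def bidualAbs (F : (Z →L[ℝ] ℝ) →L[ℝ] ℝ) (μ : Z →L[ℝ] ℝ) : ℝ :=
  sSup ((fun ν => F ν) '' {ν : Z →L[ℝ] ℝ | ∀ a : Z, 0 ≤ a → dualAbs ν a ≤ μ a})

/-- Disjointness `|F| ⊓ |G| = 0` in `Z''`. -/
def BidualDisjoint (F G : (Z →L[ℝ] ℝ) →L[ℝ] ℝ) : Prop :=
  ∀ μ : Z →L[ℝ] ℝ, dualNonneg μ → ∀ ε : ℝ, 0 < ε →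
    ∃ μ₁ μ₂ : Z →L[ℝ] ℝ, dualNonneg μ₁ ∧ dualNonneg μ₂ ∧ μ₁ + μ₂ = μ ∧
      bidualAbs F μ₁ + bidualAbs G μ₂ < ε

end DualOrder

/-- A member of the ideal center `Z(J)` of an order ideal `J` of a Riesz space, encoded as a
map defined on the ambient space whose restriction to `J` is the actual operator. -/
def IsCentralOn {D : Type*} [Lattice D] [AddCommGroup D] [Module ℝ D]
    (J : Set D) (S : D → D) : Prop :=
  (∀ f ∈ J, S f ∈ J) ∧ (∀ f ∈ J, ∀ g ∈ J, S (f + g) = S f + S g) ∧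
    (∀ (c : ℝ), ∀ f ∈ J, S (c • f) = c • S f) ∧
    ∃ c : ℝ, ∀ f ∈ J, 0 ≤ f → -(c • f) ≤ S f ∧ S f ≤ c • f

end

section PureStates

variable {V : Type*} [NormedAddCommGroup V] [NormedSpace ℝ V]

/-- The states of `V`, for the set `P` of positive elements and the order unit `u`. -/
def stateSpace (P : Set V) (u : V) : Set (WeakDual ℝ V) :=
  {φ | φ u = 1 ∧ ∀ v ∈ P, 0 ≤ φ v}

/-- The pure states of `V`, for the set `P` of positive elements and the order unit `u`. -/
def IsPureState (P : Set V) (u : V) (χ : V →L[ℝ] ℝ) : Prop :=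
  StrongDual.toWeakDual χ ∈ (stateSpace P u).extremePoints ℝ

variable {P : Set V} {u : V}

theorem abs_le_norm_of_state (hu : ∀ v, ‖v‖ • u + v ∈ P) {φ : V →L[ℝ] ℝ} (h1 : φ u = 1)
    (h2 : ∀ v ∈ P, 0 ≤ φ v) (v : V) : |φ v| ≤ ‖v‖ := by
  have h3 := h2 _ (hu v)
  have h4 := h2 _ (hu (-v))
  simp only [norm_neg, map_add, map_smul, map_neg, smul_eq_mul, h1, mul_one] at h3 h4
  rw [_root_.abs_le]
  constructor <;> linarith

theorem IsPureState.map_unit {χ : V →L[ℝ] ℝ} (hχ : IsPureState P u χ) : χ u = 1 := hχ.1.1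

theorem IsPureState.map_nonneg {χ : V →L[ℝ] ℝ} (hχ : IsPureState P u χ) {v : V} (hv : v ∈ P) :
    0 ≤ χ v := hχ.1.2 v hv

theorem isCompact_stateSpace (hu : ∀ v, ‖v‖ • u + v ∈ P) : IsCompact (stateSpace P u) := by
  refine (WeakDual.isCompact_closedBall (𝕜 := ℝ) (0 : StrongDual ℝ V) 1).of_isClosed_subset ?_ ?_
  · have : stateSpace P u = {φ | φ u = 1} ∩ ⋂ (v : V) (_ : v ∈ P), {φ | 0 ≤ φ v} := by
      ext φ
      simp [stateSpace]
    rw [this]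
    refine (isClosed_eq (WeakDual.eval_continuous _) continuous_const).inter ?_
    exact isClosed_iInter fun v => isClosed_iInter fun _ =>
      isClosed_le continuous_const (WeakDual.eval_continuous _)
  · intro φ hφ
    rw [Set.mem_preimage, mem_closedBall_zero_iff]
    exact ContinuousLinearMap.opNorm_le_bound _ zero_le_one fun v => by
      rw [one_mul]
      exact abs_le_norm_of_state hu (φ := WeakDual.toStrongDual φ) hφ.1 hφ.2 v

theorem convex_stateSpace : Convex ℝ (stateSpace P u) := by
  rintro φ ⟨h1, h2⟩ ψ ⟨h3, h4⟩ a b ha hb hab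
  refine ⟨?_, fun v hv => ?_⟩
  · change a * φ u + b * ψ u = 1
    rw [h1, h3, mul_one, mul_one, hab]
  · change 0 ≤ a * φ v + b * ψ v
    have := h2 v hv
    have := h4 v hv
    positivity

theorem state_le_of_isPureState (hu : ∀ v, ‖v‖ • u + v ∈ P) {v : V} {c : ℝ}
    (h : ∀ χ, IsPureState P u χ → χ v ≤ c) {φ : V →L[ℝ] ℝ} (h1 : φ u = 1)
    (h2 : ∀ v ∈ P, 0 ≤ φ v) : φ v ≤ c := by
  have : LocallyConvexSpace ℝ (WeakDual ℝ V) :=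
    inferInstanceAs (LocallyConvexSpace ℝ (WeakBilin (topDualPairing ℝ V)))
  have key : stateSpace P u ⊆ {φ | φ v ≤ c} := by
    rw [← closure_convexHull_extremePoints (isCompact_stateSpace hu) convex_stateSpace]
    refine closure_minimal (convexHull_min (fun χ hχ => h (WeakDual.toStrongDual χ) hχ) ?_)
      (isClosed_le (WeakDual.eval_continuous _) continuous_const)
    intro φ hφ ψ hψ a b ha hb hab
    change a * φ v + b * ψ v ≤ c
    calc a * φ v + b * ψ v ≤ a * c + b * c := add_le_add
          (mul_le_mul_of_nonneg_left hφ ha) (mul_le_mul_of_nonneg_left hψ hb)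
      _ = c := by rw [← add_mul, hab, one_mul]
  exact @key (StrongDual.toWeakDual φ) ⟨h1, h2⟩

/-- A pure state dominating a positive functional `χ ∘ T` is proportional to it. -/
theorem IsPureState.comp_eq {χ : V →L[ℝ] ℝ} (hχ : IsPureState P u χ) (T : V →L[ℝ] V)
    (hT : ∀ v ∈ P, T v ∈ P) (hT' : ∀ v ∈ P, v - T v ∈ P) (h0 : 0 < χ (T u))
    (h1 : χ (T u) < 1) (v : V) : χ (T v) = χ (T u) * χ v := by
  have hne : 1 - χ (T u) ≠ 0 := by linarith
  let ψ : V →L[ℝ] ℝ := χ.comp T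
  have h2 : StrongDual.toWeakDual ((χ (T u))⁻¹ • ψ) ∈ stateSpace P u :=
    ⟨inv_mul_cancel₀ h0.ne', fun v hv =>
      mul_nonneg (inv_nonneg.2 h0.le) (hχ.map_nonneg (hT v hv))⟩
  have h3 : StrongDual.toWeakDual ((1 - χ (T u))⁻¹ • (χ - ψ)) ∈ stateSpace P u := by
    refine ⟨?_, fun v hv => mul_nonneg (inv_nonneg.2 (by linarith)) ?_⟩
    · change (1 - χ (T u))⁻¹ * (χ u - χ (T u)) = 1
      rw [hχ.map_unit, inv_mul_cancel₀ hne]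
    · change 0 ≤ χ v - χ (T v)
      rw [← map_sub]
      exact hχ.map_nonneg (hT' v hv)
  have h4 := hχ.2 h2 h3 ⟨χ (T u), 1 - χ (T u), h0, by linarith, by ring, by
    rw [← map_smul, ← map_smul, smul_inv_smul₀ h0.ne', smul_inv_smul₀ hne, ← map_add,
      add_sub_cancel]⟩
  have h5 : (χ (T u))⁻¹ * χ (T v) = χ v := congrArg (fun φ : WeakDual ℝ V => φ v) h4
  rw [← h5, mul_inv_cancel_left₀ h0.ne']

end PureStates

section ArensProduct

variable {Z : Type*} [NormedRing Z] [NormedAlgebra ℝ Z]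

theorem arensMul_apply (F G : (Z →L[ℝ] ℝ) →L[ℝ] ℝ) (μ : Z →L[ℝ] ℝ) :
    arensMul Z F G μ = F (arensFDotL Z G μ) := rfl

theorem arensFDotL_apply (G : (Z →L[ℝ] ℝ) →L[ℝ] ℝ) (μ : Z →L[ℝ] ℝ) (a : Z) :
    arensFDotL Z G μ a = G (arensDotL Z μ a) := rfl

theorem arensDotL_apply (μ : Z →L[ℝ] ℝ) (a b : Z) : arensDotL Z μ a b = μ (a * b) := rfl

theorem arensOne_apply (μ : Z →L[ℝ] ℝ) : arensOne Z μ = μ 1 := rfl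

theorem arensMul_sub_left (F G H : (Z →L[ℝ] ℝ) →L[ℝ] ℝ) :
    arensMul Z (F - G) H = arensMul Z F H - arensMul Z G H := rfl

theorem arensOne_mul (F : (Z →L[ℝ] ℝ) →L[ℝ] ℝ) : arensMul Z (arensOne Z) F = F := by
  ext μ
  rw [arensMul_apply, arensOne_apply, arensFDotL_apply]
  congr 1
  ext a
  rw [arensDotL_apply, one_mul]

/-- Right Arens multiplication as a continuous linear map. -/
noncomputable def arensMulRight (G : (Z →L[ℝ] ℝ) →L[ℝ] ℝ) :
    ((Z →L[ℝ] ℝ) →L[ℝ] ℝ) →L[ℝ] (Z →L[ℝ] ℝ) →L[ℝ] ℝ :=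
  (ContinuousLinearMap.compL ℝ (Z →L[ℝ] ℝ) (Z →L[ℝ] ℝ) ℝ).flip (arensFDotL Z G)

theorem arensMulRight_apply (F G : (Z →L[ℝ] ℝ) →L[ℝ] ℝ) :
    arensMulRight G F = arensMul Z F G := rfl

theorem bidual_map_sub (χ : ((Z →L[ℝ] ℝ) →L[ℝ] ℝ) →L[ℝ] ℝ) (F G : (Z →L[ℝ] ℝ) →L[ℝ] ℝ) :
    χ (F - G) = χ F - χ G :=
  map_sub χ F G

theorem bidual_map_neg (χ : ((Z →L[ℝ] ℝ) →L[ℝ] ℝ) →L[ℝ] ℝ) (F : (Z →L[ℝ] ℝ) →L[ℝ] ℝ) :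
    χ (-F) = -χ F :=
  map_neg χ F

end ArensProduct

section OrderUnitAlgebra

/-- An ordered normed algebra with positive products whose norm is the order unit norm of the
algebra unit. -/
structure IsOrderUnitAlgebra (Z : Type*) [Lattice Z] [NormedRing Z] [NormedAlgebra ℝ Z] :
    Prop where
  one_nonneg : (0 : Z) ≤ 1
  mul_nonneg : ∀ a b : Z, 0 ≤ a → 0 ≤ b → 0 ≤ a * b
  le_norm : ∀ a : Z, 0 ≤ ‖a‖ • (1 : Z) + a
  norm_le : ∀ (a : Z) (c : ℝ), 0 ≤ c → 0 ≤ a + c • (1 : Z) → 0 ≤ -a + c • (1 : Z) → ‖a‖ ≤ c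

variable {Z : Type*} [Lattice Z] [NormedRing Z] [NormedAlgebra ℝ Z]

theorem arensMul_nonneg (hZ : IsOrderUnitAlgebra Z) {F G : (Z →L[ℝ] ℝ) →L[ℝ] ℝ}
    (hF : bidualLe 0 F) (hG : bidualLe 0 G) : bidualLe 0 (arensMul Z F G) := fun μ hμ =>
  hF (arensFDotL Z G μ) fun a ha =>
    hG (arensDotL Z μ a) fun b hb => hμ _ (hZ.mul_nonneg a b ha hb)

theorem IsOrderUnitAlgebra.abs_le (hZ : IsOrderUnitAlgebra Z) (μ : Z →ₗ[ℝ] ℝ)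
    (hμ : ∀ a, 0 ≤ a → 0 ≤ μ a) (a : Z) : |μ a| ≤ μ 1 * ‖a‖ := by
  have h1 := hμ _ (hZ.le_norm a)
  have h2 := hμ _ (hZ.le_norm (-a))
  simp only [norm_neg, map_add, map_smul, map_neg, smul_eq_mul] at h1 h2
  rw [_root_.abs_le]
  constructor <;> linarith

theorem dualNonneg.norm_le (hZ : IsOrderUnitAlgebra Z) {μ : Z →L[ℝ] ℝ} (hμ : dualNonneg μ) :
    ‖μ‖ ≤ μ 1 :=
  μ.opNorm_le_bound (hμ 1 hZ.one_nonneg) (hZ.abs_le μ.toLinearMap hμ)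

theorem bidual_abs_le (hZ : IsOrderUnitAlgebra Z) (F : (Z →L[ℝ] ℝ) →L[ℝ] ℝ)
    {μ : Z →L[ℝ] ℝ} (hμ : dualNonneg μ) : |F μ| ≤ ‖F‖ * μ 1 :=
  (F.le_opNorm μ).trans (mul_le_mul_of_nonneg_left (hμ.norm_le hZ) (norm_nonneg _))

/-- Jordan decomposition of a continuous functional on an order unit space. -/
theorem exists_dualNonneg_sub [CovariantClass Z Z (· + ·) (· ≤ ·)] [PosSMulMono ℝ Z]
    (hZ : IsOrderUnitAlgebra Z) (μ : Z →L[ℝ] ℝ) :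
    ∃ μ₁ μ₂ : Z →L[ℝ] ℝ, dualNonneg μ₁ ∧ dualNonneg μ₂ ∧ μ = μ₁ - μ₂ ∧
      μ₁ 1 + μ₂ 1 ≤ ‖μ‖ := by
  let C : PointedCone ℝ (Z × Z × ℝ) :=
    { carrier := {p | 0 ≤ p.1 + p.2.2 • (1 : Z) ∧ 0 ≤ p.2.1 + p.2.2 • (1 : Z) ∧ 0 ≤ p.2.2}
      zero_mem' := by simp
      smul_mem' := by
        rintro ⟨c, hc⟩ ⟨x, y, s⟩ ⟨h1, h2, h3⟩
        refine ⟨?_, ?_, mul_nonneg hc h3⟩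
        · simpa [mul_smul] using smul_nonneg hc h1
        · simpa [mul_smul] using smul_nonneg hc h2
      add_mem' := by
        rintro ⟨x, y, s⟩ ⟨x', y', s'⟩ ⟨h1, h2, h3⟩ ⟨h1', h2', h3'⟩
        refine ⟨?_, ?_, add_nonneg h3 h3'⟩
        · simpa [add_smul, add_add_add_comm] using add_nonneg h1 h1'
        · simpa [add_smul, add_add_add_comm] using add_nonneg h2 h2' }
  let L : Z × Z × ℝ →ₗ[ℝ] ℝ :=
    μ.toLinearMap ∘ₗ LinearMap.fst ℝ Z (Z × ℝ) +
      ‖μ‖ • (LinearMap.snd ℝ Z ℝ ∘ₗ LinearMap.snd ℝ Z (Z × ℝ))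
  have hL : ∀ x y s, L (x, y, s) = μ x + ‖μ‖ * s := fun x y s => rfl
  let W : Submodule ℝ (Z × Z × ℝ) :=
    LinearMap.ker (LinearMap.fst ℝ Z (Z × ℝ) + LinearMap.fst ℝ Z ℝ ∘ₗ LinearMap.snd ℝ Z (Z × ℝ))
  have hW : ∀ x y s, (x, y, s) ∈ W ↔ x + y = 0 := fun x y s => Iff.rfl
  obtain ⟨g, hg, hpos⟩ := riesz_extension C ⟨W, L ∘ₗ W.subtype⟩
    (by
      rintro ⟨⟨x, y, s⟩, hw⟩ ⟨h1, h2, h3⟩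
      rw [hW] at hw
      obtain rfl : y = -x := (neg_eq_of_add_eq_zero_right hw).symm
      have h4 := hZ.norm_le x s h3 h1 h2
      have h5 := μ.le_opNorm x
      rw [Real.norm_eq_abs] at h5
      have h6 := mul_le_mul_of_nonneg_left h4 (norm_nonneg μ)
      have h7 := neg_abs_le (μ x)
      change 0 ≤ L (x, -x, s)
      rw [hL]
      linarith)
    (by
      rintro ⟨x, y, s⟩
      refine ⟨⟨(0, 0, ‖x‖ + ‖y‖ + |s| - s), (hW _ _ _).2 (add_zero 0)⟩, ?_, ?_, ?_⟩
      · have h1 := hZ.le_norm x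
        have h2 : 0 ≤ (‖y‖ + |s|) • (1 : Z) := smul_nonneg (by positivity) hZ.one_nonneg
        have h3 := add_nonneg h1 h2
        convert h3 using 1
        simp only [Prod.mk_add_mk]
        module
      · have h1 := hZ.le_norm y
        have h2 : 0 ≤ (‖x‖ + |s|) • (1 : Z) := smul_nonneg (by positivity) hZ.one_nonneg
        have h3 := add_nonneg h1 h2
        convert h3 using 1
        simp only [Prod.mk_add_mk]
        module
      · simp only [Prod.mk_add_mk]
        have := abs_nonneg s
        have := norm_nonneg x
        have := norm_nonneg y
        linarith)
  have hg' : ∀ x s, g (x, -x, s) = μ x + ‖μ‖ * s := fun x s =>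
    hg ⟨(x, -x, s), (hW _ _ _).2 (add_neg_cancel x)⟩
  let g₁ : Z →ₗ[ℝ] ℝ := g ∘ₗ LinearMap.inl ℝ Z (Z × ℝ)
  let g₂ : Z →ₗ[ℝ] ℝ := g ∘ₗ LinearMap.inr ℝ Z (Z × ℝ) ∘ₗ LinearMap.inl ℝ Z ℝ
  have h1 : ∀ a, 0 ≤ a → 0 ≤ g₁ a := fun a ha => hpos (a, 0, 0) ⟨by simpa, by simp, le_rfl⟩
  have h2 : ∀ a, 0 ≤ a → 0 ≤ g₂ a := fun a ha => hpos (0, a, 0) ⟨by simp, by simpa, le_rfl⟩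
  refine ⟨g₁.mkContinuous (g₁ 1) (hZ.abs_le g₁ h1), g₂.mkContinuous (g₂ 1) (hZ.abs_le g₂ h2),
    h1, h2, ?_, ?_⟩
  · ext a
    have h := hg' a 0
    rw [mul_zero, add_zero] at h
    rw [← h]
    change g (a, -a, 0) = g (a, 0, 0) - g (0, a, 0)
    rw [← map_sub]
    simp
  · have h3 := hpos (-1, -1, 1) ⟨by simp, by simp, zero_le_one⟩
    have h4 := hg' 0 1
    rw [map_zero, zero_add, mul_one, neg_zero] at h4
    have h5 : g (-1, -1, 1) = g (0, 0, 1) - (g (1, 0, 0) + g (0, 1, 0)) := by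
      rw [← map_add, ← map_sub]
      simp
    change g (1, 0, 0) + g (0, 1, 0) ≤ ‖μ‖
    linarith

/-- The pure states of the bidual of an order unit algebra. -/
def IsBidualPure (χ : ((Z →L[ℝ] ℝ) →L[ℝ] ℝ) →L[ℝ] ℝ) : Prop :=
  IsPureState {F | bidualLe 0 F} (arensOne Z) χ

theorem bidualLe_norm_add (hZ : IsOrderUnitAlgebra Z) (F : (Z →L[ℝ] ℝ) →L[ℝ] ℝ) :
    bidualLe 0 (‖F‖ • arensOne Z + F) := fun μ hμ => by
  have := neg_abs_le (F μ)
  have := bidual_abs_le hZ F hμ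
  change 0 ≤ ‖F‖ * μ 1 + F μ
  linarith

theorem IsBidualPure.abs_le (hZ : IsOrderUnitAlgebra Z)
    {χ : ((Z →L[ℝ] ℝ) →L[ℝ] ℝ) →L[ℝ] ℝ} (hχ : IsBidualPure χ)
    (F : (Z →L[ℝ] ℝ) →L[ℝ] ℝ) : |χ F| ≤ ‖F‖ :=
  abs_le_norm_of_state (P := {F | bidualLe 0 F}) (u := arensOne Z) (bidualLe_norm_add hZ)
    hχ.map_unit (fun _ h => hχ.map_nonneg h) F

/-- Pure states of the bidual determine the order. -/
theorem bidual_le_of_pure (hZ : IsOrderUnitAlgebra Z) {F : (Z →L[ℝ] ℝ) →L[ℝ] ℝ} {c : ℝ}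
    (h : ∀ χ, IsBidualPure χ → χ F ≤ c) {μ : Z →L[ℝ] ℝ} (hμ : dualNonneg μ) :
    F μ ≤ c * μ 1 := by
  rcases (hμ 1 hZ.one_nonneg).eq_or_lt with h0 | h0
  · have h1 := le_abs_self (F μ)
    have h2 := bidual_abs_le hZ F hμ
    rw [← h0, mul_zero] at h2 ⊢
    linarith
  · have h1 := state_le_of_isPureState (P := {F | bidualLe 0 F}) (u := arensOne Z)
      (bidualLe_norm_add hZ) h
      (φ := ContinuousLinearMap.apply ℝ ℝ ((μ 1)⁻¹ • μ)) (inv_mul_cancel₀ h0.ne')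
      (fun G hG => hG _ fun a ha => mul_nonneg (inv_nonneg.2 h0.le) (hμ a ha))
    change F ((μ 1)⁻¹ • μ) ≤ c at h1
    rwa [map_smul, smul_eq_mul, inv_mul_le_iff₀ h0, mul_comm] at h1

theorem bidual_abs_le_of_pure (hZ : IsOrderUnitAlgebra Z) {F : (Z →L[ℝ] ℝ) →L[ℝ] ℝ} {c : ℝ}
    (h : ∀ χ, IsBidualPure χ → |χ F| ≤ c) {μ : Z →L[ℝ] ℝ}
    (hμ : dualNonneg μ) : |F μ| ≤ c * μ 1 := by
  rw [_root_.abs_le]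
  have h1 := bidual_le_of_pure hZ (F := F) (fun χ hχ => (_root_.abs_le.1 (h χ hχ)).2) hμ
  have h2 := bidual_le_of_pure hZ (F := -F) (c := c)
    (fun χ hχ => by rw [bidual_map_neg]; linarith [(_root_.abs_le.1 (h χ hχ)).1]) hμ
  rw [neg_apply] at h2
  exact ⟨by linarith, h1⟩

theorem bidual_norm_le_of_pure [CovariantClass Z Z (· + ·) (· ≤ ·)] [PosSMulMono ℝ Z]
    (hZ : IsOrderUnitAlgebra Z) {F : (Z →L[ℝ] ℝ) →L[ℝ] ℝ} {c : ℝ} (hc : 0 ≤ c)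
    (h : ∀ χ, IsBidualPure χ → |χ F| ≤ c) : ‖F‖ ≤ c := by
  refine F.opNorm_le_bound hc fun μ => ?_
  obtain ⟨μ₁, μ₂, h1, h2, h3, h4⟩ := exists_dualNonneg_sub hZ μ
  calc |F μ| = |F μ₁ - F μ₂| := by rw [h3, map_sub]
    _ ≤ |F μ₁| + |F μ₂| := abs_sub _ _
    _ ≤ c * μ₁ 1 + c * μ₂ 1 :=
      add_le_add (bidual_abs_le_of_pure hZ h h1) (bidual_abs_le_of_pure hZ h h2)
    _ = c * (μ₁ 1 + μ₂ 1) := by ring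
    _ ≤ c * ‖μ‖ := mul_le_mul_of_nonneg_left h4 hc

theorem bidual_ext_of_pure [CovariantClass Z Z (· + ·) (· ≤ ·)] [PosSMulMono ℝ Z]
    (hZ : IsOrderUnitAlgebra Z) {F G : (Z →L[ℝ] ℝ) →L[ℝ] ℝ}
    (h : ∀ χ, IsBidualPure χ → χ F = χ G) : F = G := by
  refine sub_eq_zero.1 (norm_le_zero_iff.1 ?_)
  exact bidual_norm_le_of_pure hZ le_rfl fun χ hχ => by rw [bidual_map_sub, h χ hχ, sub_self, abs_zero]

/-- Pure states of the bidual are multiplicative. -/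
theorem IsBidualPure.map_mul (hZ : IsOrderUnitAlgebra Z)
    {χ : ((Z →L[ℝ] ℝ) →L[ℝ] ℝ) →L[ℝ] ℝ} (hχ : IsBidualPure χ)
    (F G : (Z →L[ℝ] ℝ) →L[ℝ] ℝ) : χ (arensMul Z F G) = χ F * χ G := by
  have mulOne : ∀ F G, χ (arensMul Z F (arensOne Z + G)) = χ F + χ (arensMul Z F G) := by
    intro F G
    have : arensFDotL Z (arensOne Z + G) = ContinuousLinearMap.id ℝ _ + arensFDotL Z G := by
      ext μ a
      change μ (a * 1) + G _ = μ a + G _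
      rw [mul_one]
    rw [← map_add]
    congr 1
    ext μ
    rw [arensMul_apply, this]
    exact map_add F μ (arensFDotL Z G μ)
  have smulR : ∀ (c : ℝ) F G, χ (arensMul Z F (c • G)) = c * χ (arensMul Z F G) := by
    intro c F G
    rw [← smul_eq_mul, ← map_smul]
    congr 1
    ext μ
    exact F.map_smul c (arensFDotL Z G μ)
  set r : ℝ := (2 * (‖G‖ + 1))⁻¹ with hr
  have hr0 : 0 < r := by positivity
  have hrG : r * ‖G‖ ≤ 1 / 2 := by
    rw [hr, inv_mul_le_iff₀ (by positivity)]
    linarith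
  set H : (Z →L[ℝ] ℝ) →L[ℝ] ℝ := (1 / 2 : ℝ) • (arensOne Z + r • G) with hH
  have hHval : χ H = 1 / 2 * (1 + r * χ G) := by
    rw [hH, map_smul, map_add, map_smul, hχ.map_unit]
    rfl
  have hGle := _root_.abs_le.1 (hχ.abs_le hZ G)
  have ht0 : 0 < χ H := by
    rw [hHval]
    nlinarith
  have ht1 : χ H < 1 := by
    rw [hHval]
    nlinarith
  have hHpos : bidualLe 0 H := fun μ hμ => by
    have h1 := neg_abs_le (G μ)
    have h2 := bidual_abs_le hZ G hμ
    have h3 := mul_le_mul_of_nonneg_left h2 hr0.le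
    have h4 := hμ 1 hZ.one_nonneg
    change 0 ≤ 1 / 2 * (μ 1 + r * G μ)
    nlinarith
  have hHle : bidualLe 0 (arensOne Z - H) := fun μ hμ => by
    have h1 := le_abs_self (G μ)
    have h2 := bidual_abs_le hZ G hμ
    have h3 := mul_le_mul_of_nonneg_left h2 hr0.le
    have h4 := hμ 1 hZ.one_nonneg
    change 0 ≤ μ 1 - 1 / 2 * (μ 1 + r * G μ)
    nlinarith
  have hmulH : ∀ F, χ (arensMul Z F H) = 1 / 2 * (χ F + r * χ (arensMul Z F G)) := fun F => by
    rw [hH, smulR, mulOne, smulR]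
  have hsub : ∀ F, F - arensMul Z F H = arensMul Z F (arensOne Z - H) := fun F => by
    ext μ
    change F μ - F _ = F _
    rw [← map_sub]
    congr 1
    ext a
    change μ a - H _ = μ (a * 1) - H _
    rw [mul_one]
  have h4 := hχ.comp_eq (arensMulRight H) (fun F hF => arensMul_nonneg hZ hF hHpos)
    (fun F hF => by
      rw [arensMulRight_apply, hsub]
      exact arensMul_nonneg hZ hF hHle)
  simp only [arensMulRight_apply, arensOne_mul] at h4
  have h4 := h4 ht0 ht1 F
  rw [hmulH, hHval] at h4
  have h5 : r * χ (arensMul Z F G) = r * (χ F * χ G) := by linarith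
  exact mul_left_cancel₀ hr0.ne' h5

variable [CovariantClass Z Z (· + ·) (· ≤ ·)] [PosSMulMono ℝ Z]

theorem arensMul_comm (hZ : IsOrderUnitAlgebra Z) (F G : (Z →L[ℝ] ℝ) →L[ℝ] ℝ) :
    arensMul Z F G = arensMul Z G F :=
  bidual_ext_of_pure hZ fun χ hχ => by
    rw [hχ.map_mul hZ, hχ.map_mul hZ, mul_comm]

theorem IsOrderUnitAlgebra.mul_comm (hZ : IsOrderUnitAlgebra Z) (a b : Z) : a * b = b * a :=
  (SeparatingDual.eq_iff_forall_dual_eq (R := ℝ)).2 fun μ =>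
    DFunLike.congr_fun (arensMul_comm hZ (ContinuousLinearMap.apply ℝ ℝ a)
      (ContinuousLinearMap.apply ℝ ℝ b)) μ

end OrderUnitAlgebra

section WeakStarIdeal

variable {Z : Type*} [Lattice Z] [NormedRing Z] [NormedAlgebra ℝ Z]

theorem abs_one_sub_pow_mul_le {t y c : ℝ} (ht0 : 0 ≤ t) (ht1 : t ≤ 1) (hy : y ^ 2 ≤ c * t)
    {ε : ℝ} (hε : 0 < ε) {n : ℕ} (hn : c ≤ ε ^ 2 * n) :
    |(1 - t) ^ n * y| ≤ ε := by
  have hs0 : 0 ≤ (1 - t) ^ n := pow_nonneg (by linarith) n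
  have hs1 : (1 - t) ^ n ≤ 1 := pow_le_one₀ (by linarith) (by linarith)
  have h1 : 1 + n * t ≤ (1 + t) ^ n := one_add_mul_le_pow (by linarith) n
  have h2 : (1 + t) ^ n * (1 - t) ^ n ≤ 1 := by
    rw [← mul_pow]
    exact pow_le_one₀ (by nlinarith) (by nlinarith)
  have h3 : n * t * (1 - t) ^ n ≤ 1 := by nlinarith
  refine abs_le_of_sq_le_sq ?_ hε.le
  calc ((1 - t) ^ n * y) ^ 2 = (1 - t) ^ n * ((1 - t) ^ n * y ^ 2) := by ring
    _ ≤ 1 * ((1 - t) ^ n * y ^ 2) := by gcongr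
    _ = (1 - t) ^ n * y ^ 2 := one_mul _
    _ ≤ (1 - t) ^ n * (c * t) := by gcongr
    _ ≤ (1 - t) ^ n * (ε ^ 2 * n * t) := by gcongr
    _ = ε ^ 2 * (n * t * (1 - t) ^ n) := by ring
    _ ≤ ε ^ 2 * 1 := by gcongr
    _ = ε ^ 2 := mul_one _

/-- Ideals of the bidual have approximate units between `0` and `1`. -/
theorem exists_approx_unit (hZ : IsOrderUnitAlgebra Z)
    (N : Submodule ℝ ((Z →L[ℝ] ℝ) →L[ℝ] ℝ)) (hN : ∀ F ∈ N, ∀ G, arensMul Z F G ∈ N)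
    (s : Finset ((Z →L[ℝ] ℝ) →L[ℝ] ℝ)) (hs : ∀ F ∈ s, F ∈ N) {ε : ℝ} (hε : 0 < ε) :
    ∃ e ∈ N, (∀ χ, IsBidualPure χ → |χ e| ≤ 1) ∧
      ∀ F ∈ s, ∀ χ, IsBidualPure χ → |χ (arensMul Z e F - F)| ≤ ε := by
  set G : (Z →L[ℝ] ℝ) →L[ℝ] ℝ := ∑ F ∈ s, arensMul Z F F with hG
  have hGN : G ∈ N := Submodule.sum_mem _ fun F hF => hN F (hs F hF) F
  have hχG : ∀ χ, IsBidualPure χ → χ G = ∑ F ∈ s, χ F ^ 2 := fun χ hχ => by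
    rw [hG, map_sum]
    exact Finset.sum_congr rfl fun F _ => by rw [hχ.map_mul hZ, sq]
  set c : ℝ := ‖G‖ + 1
  have hc : 0 < c := by positivity
  have hχH : ∀ χ, IsBidualPure χ → χ (c⁻¹ • G) = c⁻¹ * χ G := fun χ _ => map_smul χ _ _
  have approx : ∀ n : ℕ, ∃ e ∈ N, ∀ χ, IsBidualPure χ → χ e = 1 - (1 - c⁻¹ * χ G) ^ n := by
    intro n
    induction n with
    | zero => exact ⟨0, N.zero_mem, fun χ _ => by simp⟩
    | succ n ih =>
      obtain ⟨e, he, h⟩ := ih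
      have hH : c⁻¹ • G ∈ N := N.smul_mem _ hGN
      refine ⟨e + c⁻¹ • G + (-1 : ℝ) • arensMul Z (c⁻¹ • G) e,
        N.add_mem (N.add_mem he hH) (N.smul_mem _ (hN _ hH e)), fun χ hχ => ?_⟩
      rw [map_add, map_add, hχH χ hχ, map_smul, hχ.map_mul hZ, h χ hχ, hχH χ hχ, smul_eq_mul]
      ring
  obtain ⟨n, hn⟩ := exists_nat_ge (c / ε ^ 2)
  rw [div_le_iff₀' (by positivity)] at hn
  obtain ⟨e, he, h⟩ := approx n
  have ht0 : ∀ χ, IsBidualPure χ → 0 ≤ c⁻¹ * χ G := fun χ hχ => by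
    rw [hχG χ hχ]
    positivity
  have ht1 : ∀ χ, IsBidualPure χ → c⁻¹ * χ G ≤ 1 := fun χ hχ => by
    rw [inv_mul_le_iff₀ hc, mul_one]
    have := le_abs_self (χ G)
    have := hχ.abs_le hZ G
    linarith
  refine ⟨e, he, fun χ hχ => ?_, fun F hF χ hχ => ?_⟩
  · rw [h χ hχ]
    have h0 : 0 ≤ (1 - c⁻¹ * χ G) ^ n := pow_nonneg (by linarith [ht1 χ hχ]) n
    have h1 : (1 - c⁻¹ * χ G) ^ n ≤ 1 :=
      pow_le_one₀ (by linarith [ht1 χ hχ]) (by linarith [ht0 χ hχ])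
    rw [_root_.abs_le]
    constructor <;> linarith
  · have h1 : χ (arensMul Z e F - F) = -((1 - c⁻¹ * χ G) ^ n * χ F) := by
      rw [bidual_map_sub, hχ.map_mul hZ, h χ hχ]
      ring
    rw [h1, abs_neg]
    refine abs_one_sub_pow_mul_le (ht0 χ hχ) (ht1 χ hχ) (c := c) ?_ hε hn
    rw [mul_inv_cancel_left₀ hc.ne', hχG χ hχ]
    exact Finset.single_le_sum (f := fun F => χ F ^ 2) (fun F _ => sq_nonneg _) hF

variable [CovariantClass Z Z (· + ·) (· ≤ ·)] [PosSMulMono ℝ Z]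

/-- A weak-star closed ideal of the bidual has a unit. -/
theorem exists_unit_of_annihilator (hZ : IsOrderUnitAlgebra Z) (M : Set (Z →L[ℝ] ℝ))
    (hM : ∀ F : (Z →L[ℝ] ℝ) →L[ℝ] ℝ, (∀ μ ∈ M, F μ = 0) →
      ∀ G, ∀ μ ∈ M, arensMul Z F G μ = 0) :
    ∃ e : (Z →L[ℝ] ℝ) →L[ℝ] ℝ, (∀ μ ∈ M, e μ = 0) ∧
      ∀ F : (Z →L[ℝ] ℝ) →L[ℝ] ℝ, (∀ μ ∈ M, F μ = 0) → arensMul Z e F = F := by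
  classical
  let N : Submodule ℝ ((Z →L[ℝ] ℝ) →L[ℝ] ℝ) :=
    { carrier := {F | ∀ μ ∈ M, F μ = 0}
      zero_mem' := fun _ _ => rfl
      add_mem' := fun {F G} hF hG μ hμ => by
        change F μ + G μ = 0
        rw [hF μ hμ, hG μ hμ, add_zero]
      smul_mem' := fun c F hF μ hμ => by
        change c * F μ = 0
        rw [hF μ hμ, mul_zero] }
  have approx : ∀ i : Finset N × ℕ, ∃ e ∈ N, (∀ χ, IsBidualPure χ → |χ e| ≤ 1) ∧
      ∀ F ∈ i.1, ∀ χ, IsBidualPure χ →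
        |χ (arensMul Z e F.1 - F.1)| ≤ 1 / ((i.2 : ℝ) + 1) := by
    rintro ⟨s, k⟩
    obtain ⟨e, he, h1, h2⟩ := exists_approx_unit hZ N hM (s.image Subtype.val)
      (by simp +contextual) (ε := 1 / ((k : ℝ) + 1)) (by positivity)
    exact ⟨e, he, h1, fun F hF => h2 F.1 (Finset.mem_image_of_mem _ hF)⟩
  choose e he h1 h2 using approx
  let U : Ultrafilter (Finset N × ℕ) := Ultrafilter.of Filter.atTop
  have hU : (U : Filter (Finset N × ℕ)) ≤ Filter.atTop := Ultrafilter.of_le _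
  obtain ⟨x, -, hx⟩ := (WeakDual.isCompact_closedBall (𝕜 := ℝ)
    (0 : StrongDual ℝ (Z →L[ℝ] ℝ)) 1).ultrafilter_le_nhds'
      (U.map fun i => StrongDual.toWeakDual (e i))
      (Ultrafilter.mem_map.2 <| Filter.univ_mem' fun i => by
        exact (mem_closedBall_zero_iff (a := (show StrongDual ℝ (Z →L[ℝ] ℝ) from e i))).2
          (bidual_norm_le_of_pure hZ zero_le_one (h1 i)))
  have hlim : ∀ μ : Z →L[ℝ] ℝ,
      Filter.Tendsto (fun i => e i μ) U (nhds (WeakDual.toStrongDual x μ)) := fun μ =>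
    ((WeakDual.eval_continuous μ).tendsto x).comp hx
  refine ⟨WeakDual.toStrongDual x, fun μ hμ => ?_, fun F hF => ?_⟩
  · refine tendsto_nhds_unique (hlim μ) ?_
    simp only [he _ μ hμ]
    exact tendsto_const_nhds
  · have pos : ∀ μ : Z →L[ℝ] ℝ, dualNonneg μ →
        arensMul Z (WeakDual.toStrongDual x) F μ = F μ := fun μ hμ => by
      refine tendsto_nhds_unique (hlim (arensFDotL Z F μ)) ?_
      rw [tendsto_iff_norm_sub_tendsto_zero]
      refine squeeze_zero' (g := fun i => 1 / ((i.2 : ℝ) + 1) * μ 1)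
        (Filter.Eventually.of_forall fun _ => norm_nonneg _) ?_ ?_
      · refine hU ?_
        filter_upwards [Filter.eventually_ge_atTop ({⟨F, hF⟩}, 0)] with i hi
        exact bidual_abs_le_of_pure hZ (F := arensMul Z (e i) F - F)
          (h2 i ⟨F, hF⟩ (Finset.singleton_subset_iff.1 hi.1)) hμ
      · rw [← zero_mul (μ 1)]
        refine Filter.Tendsto.mul_const _ ?_
        refine (tendsto_one_div_add_atTop_nhds_zero_nat (𝕜 := ℝ)).comp ?_
        refine Filter.Tendsto.mono_left ?_ hU
        rw [← Filter.prod_atTop_atTop_eq]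
        exact Filter.tendsto_snd
    ext μ
    obtain ⟨μ₁, μ₂, p1, p2, rfl, -⟩ := exists_dualNonneg_sub hZ μ
    rw [map_sub, map_sub, pos _ p1, pos _ p2]

end WeakStarIdeal

section Center

/-- A linear map dominated by a nonnegative multiple of the identity is central. -/
theorem isCentral_of_linear {D : Type*} [Lattice D] [AddCommGroup D] [Module ℝ D]
    [CovariantClass D D (· + ·) (· ≤ ·)] [PosSMulMono ℝ D] {T : D → D}
    (hT : IsLinearMap ℝ T) {c : ℝ} (hc0 : 0 ≤ c)
    (hc : ∀ f : D, 0 ≤ f → -(c • f) ≤ T f ∧ T f ≤ c • f) : IsCentral T := by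
  have smul_mono : ∀ (k : ℝ) (a b : D), 0 ≤ k → a ≤ b → k • a ≤ k • b := fun k a b hk hab =>
    smul_le_smul_of_nonneg_left hab hk
  refine ⟨⟨hT, fun a b => ?_, fun f g hfg => ?_⟩, c, hc⟩
  · refine ⟨T a - c • (b - a), T a + c • (b - a), fun x hax hxb => ?_⟩
    have h1 : c • (x - a) ≤ c • (b - a) := smul_mono _ _ _ hc0 (sub_le_sub_right hxb a)
    obtain ⟨h2, h3⟩ := hc _ (sub_nonneg.2 hax)
    rw [hT.map_sub] at h2 h3
    exact ⟨sub_le_comm.1 ((neg_le.1 h2).trans' (neg_sub (T x) (T a)).ge |>.trans h1),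
      sub_le_iff_le_add'.1 (h3.trans h1)⟩
  · have habs : |T f| ≤ c • |f| := by
      obtain ⟨h1, h2⟩ := hc _ (posPart_nonneg f)
      obtain ⟨h3, h4⟩ := hc _ (negPart_nonneg f)
      have hf : T f = T f⁺ - T f⁻ := by rw [← hT.map_sub, posPart_sub_negPart]
      rw [← posPart_add_negPart f, smul_add, hf, abs_le', neg_sub, sub_eq_add_neg,
        sub_eq_add_neg, add_comm (c • f⁺)]
      constructor
      · rw [add_comm]
        exact add_le_add (neg_le.1 h3) h2
      · exact add_le_add h4 (neg_le.1 h1)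
    have hk : 0 < c + 1 := by linarith
    set w := |T f| ⊓ |g|
    have hw0 : 0 ≤ w := le_inf (abs_nonneg _) (abs_nonneg _)
    have key : ∀ v : D, w ≤ (c + 1) • v → (c + 1)⁻¹ • w ≤ v := fun v hv =>
      (smul_mono _ _ _ (inv_nonneg.2 hk.le) hv).trans_eq (inv_smul_smul₀ hk.ne' v)
    have hwf : (c + 1)⁻¹ • w ≤ |f| := key _ <| by
      rw [add_smul, one_smul]
      exact (inf_le_left.trans habs).trans (le_add_of_nonneg_right (abs_nonneg f))
    have hwg : (c + 1)⁻¹ • w ≤ |g| := key _ <| by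
      rw [add_smul, one_smul]
      exact inf_le_right.trans (le_add_of_nonneg_left (smul_nonneg hc0 (abs_nonneg g)))
    have h := smul_mono _ _ _ hk.le ((le_inf hwf hwg).trans_eq hfg)
    rw [smul_inv_smul₀ hk.ne', smul_zero] at h
    exact le_antisymm h hw0

variable {E D Z : Type*}
    [Lattice E] [AddCommGroup E] [Module ℝ E]
    [Lattice D] [AddCommGroup D] [Module ℝ D]
    [Lattice Z] [NormedRing Z] [NormedAlgebra ℝ Z]
    {pE : D → E → ℝ} {ρ : Z → E → E}

theorem IsCenterOf.nonneg_iff (hZ : IsCenterOf E Z ρ) (a : Z) :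
    0 ≤ a ↔ ∀ x, 0 ≤ x → 0 ≤ ρ a x := by
  rw [hZ.le_iff]
  simp only [(hZ.lin_vec _).map_zero]

theorem IsCenterOf.isOrderUnitAlgebra [CovariantClass E E (· + ·) (· ≤ ·)]
    (hZ : IsCenterOf E Z ρ) : IsOrderUnitAlgebra Z := by
  have hρ : ∀ (a : Z) (c : ℝ) (x : E), ρ (a + c • 1) x = ρ a x + c • x := fun a c x => by
    rw [(hZ.lin_vec x).map_add, (hZ.lin_vec x).map_smul, hZ.map_one]
  have hneg : ∀ (a : Z) (x : E), ρ (-a) x = -ρ a x := fun a x => (hZ.lin_vec x).map_neg a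
  refine ⟨?_, fun a b ha hb => ?_, fun a => ?_, fun a c hc h1 h2 => ?_⟩
  · rw [hZ.nonneg_iff]
    intro x hx
    rwa [hZ.map_one]
  · rw [hZ.nonneg_iff] at *
    intro x hx
    rw [hZ.map_mul]
    exact ha _ (hb x hx)
  · rw [hZ.nonneg_iff]
    intro x hx
    rw [add_comm, hρ]
    exact neg_le_iff_add_nonneg.1 ((hZ.norm_le_iff a ‖a‖ (norm_nonneg a)).1 le_rfl x hx).1
  · rw [hZ.nonneg_iff] at h1 h2
    rw [hZ.norm_le_iff a c hc]
    intro x hx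
    have h3 := h1 x hx
    have h4 := h2 x hx
    rw [hρ] at h3 h4
    rw [hneg, add_comm, ← sub_eq_add_neg, sub_nonneg] at h4
    exact ⟨neg_le_iff_add_nonneg.2 h3, h4⟩

theorem dualNonneg_of_eq (hD : IsOrderDual E D pE) (hZ : IsCenterOf E Z ρ) {f : D} (hf : 0 ≤ f)
    {x : E} (hx : 0 ≤ x) (T : Z) (hT : 0 ≤ T) : 0 ≤ pE f (ρ T x) := by
  have h := (hD.le_iff 0 f).1 hf _ ((hZ.nonneg_iff T).1 hT x hx)
  rwa [(hD.lin_vec _).map_zero] at h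

theorem exists_functional [CovariantClass E E (· + ·) (· ≤ ·)]
    [CovariantClass D D (· + ·) (· ≤ ·)] (hD : IsOrderDual E D pE)
    (hZ : IsCenterOf E Z ρ) (f : D) (x : E) :
    ∃ μ : Z →L[ℝ] ℝ, ∀ T, μ T = pE f (ρ T x) := by
  have pos : ∀ (f : D) (x : E), 0 ≤ f → 0 ≤ x →
      ∃ μ : Z →L[ℝ] ℝ, ∀ T, μ T = pE f (ρ T x) := fun f x hf hx =>
    ⟨LinearMap.mkContinuous
      { toFun := fun T => pE f (ρ T x)
        map_add' := fun S T => by rw [(hZ.lin_vec x).map_add, (hD.lin_fun f).map_add]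
        map_smul' := fun c T => by
          rw [(hZ.lin_vec x).map_smul, (hD.lin_fun f).map_smul, RingHom.id_apply] }
      _ (hZ.isOrderUnitAlgebra.abs_le _ (dualNonneg_of_eq hD hZ hf hx)), fun T => rfl⟩
  obtain ⟨μ₁, h1⟩ := pos f⁺ x⁺ (posPart_nonneg f) (posPart_nonneg x)
  obtain ⟨μ₂, h2⟩ := pos f⁺ x⁻ (posPart_nonneg f) (negPart_nonneg x)
  obtain ⟨μ₃, h3⟩ := pos f⁻ x⁺ (negPart_nonneg f) (posPart_nonneg x)
  obtain ⟨μ₄, h4⟩ := pos f⁻ x⁻ (negPart_nonneg f) (negPart_nonneg x)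
  refine ⟨(μ₁ - μ₂) - (μ₃ - μ₄), fun T => ?_⟩
  change (μ₁ T - μ₂ T) - (μ₃ T - μ₄ T) = _
  rw [h1, h2, h3, h4, ← (hD.lin_fun _).map_sub, ← (hD.lin_fun _).map_sub,
    ← (hZ.central T).1.1.map_sub, posPart_sub_negPart, ← (hD.lin_vec _).map_sub,
    posPart_sub_negPart]

end Center

/-- Proposition 5, structure of `Z(E^∼)`.  Let `E` be a Riesz space with
point separating order dual (realized as `D`) whose Arens homomorphism
`m : Z(E)'' → Z(E^∼)` is surjective.  Then there is an idempotent `π ∈ Z(E)''` (for the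
Arens product) such that `Ker(m) = (1-π)⬝Z(E)''` and `Z(E^∼) = m(π⬝Z(E)'')`, so that
`Z(E^∼)` is identified with `π⬝Z(E)''`. -/
theorem statement8
    {E D Z : Type*}
    [Lattice E] [AddCommGroup E] [Module ℝ E]
    [CovariantClass E E (· + ·) (· ≤ ·)] [PosSMulMono ℝ E]
    [Lattice D] [AddCommGroup D] [Module ℝ D]
    [CovariantClass D D (· + ·) (· ≤ ·)] [PosSMulMono ℝ D]
    [Lattice Z] [NormedRing Z] [NormedAlgebra ℝ Z]
    [CovariantClass Z Z (· + ·) (· ≤ ·)] [PosSMulMono ℝ Z]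
    (pE : D → E → ℝ) (hD : IsOrderDual E D pE) (hsep : SepPoints pE)
    (ρ : Z → E → E) (hZ : IsCenterOf E Z ρ)
    (m : ((Z →L[ℝ] ℝ) →L[ℝ] ℝ) → D → D)
    (hm : ∀ (F : (Z →L[ℝ] ℝ) →L[ℝ] ℝ) (f : D) (x : E) (μ : Z →L[ℝ] ℝ),
      (∀ T : Z, μ T = pE f (ρ T x)) → pE (m F f) x = F μ)
    -- `m` is surjective onto `Z(E^∼)`:
    (hsurj : ∀ S : D → D, IsCentral S → ∃ F : (Z →L[ℝ] ℝ) →L[ℝ] ℝ, ∀ f : D, m F f = S f) :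
    ∃ π : (Z →L[ℝ] ℝ) →L[ℝ] ℝ,
      -- `π` is an idempotent of the Arens algebra `Z(E)''`:
      arensMul Z π π = π ∧
      -- `Ker(m) = (1-π)⬝Z(E)''`:
      {F : (Z →L[ℝ] ℝ) →L[ℝ] ℝ | ∀ f : D, m F f = 0} =
        Set.range (fun F => arensMul Z (arensOne Z - π) F) ∧
      -- `Z(E^∼) = m(π⬝Z(E)'')`:
      {S : D → D | IsCentral S} = Set.range (fun F => m (arensMul Z π F)) := by
  classical
  have hA := hZ.isOrderUnitAlgebra
  choose K hK using exists_functional hD hZ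
  have hmK : ∀ F f x, pE (m F f) x = F (K f x) := fun F f x => hm F f x _ (hK f x)
  have hker : ∀ F, (∀ f, m F f = 0) ↔ ∀ μ ∈ {μ | ∃ f x, K f x = μ}, F μ = 0 := by
    intro F
    have h0 : ∀ x, pE 0 x = 0 := fun x => (hD.lin_vec x).map_zero
    constructor
    · rintro h _ ⟨f, x, rfl⟩
      rw [← hmK, h, h0]
    · intro h f
      exact hD.inj _ _ fun x => by rw [hmK, h _ ⟨f, x, rfl⟩, h0]
  have hmul : ∀ F G f x, arensMul Z F G (K f x) = F (K (m G f) x) := by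
    intro F G f x
    rw [arensMul_apply]
    congr 1
    ext a
    rw [arensFDotL_apply, hK, hmK]
    congr 1
    ext b
    rw [arensDotL_apply, hK, hK, hA.mul_comm, hZ.map_mul]
  have hideal : ∀ F : (Z →L[ℝ] ℝ) →L[ℝ] ℝ, (∀ μ ∈ {μ | ∃ f x, K f x = μ}, F μ = 0) →
      ∀ G, ∀ μ ∈ {μ | ∃ f x, K f x = μ}, arensMul Z F G μ = 0 := by
    rintro F hF G _ ⟨f, x, rfl⟩
    rw [hmul]
    exact hF _ ⟨_, _, rfl⟩
  have hcentral : ∀ F, IsCentral (m F) := by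
    intro F
    refine isCentral_of_linear ⟨fun f g => ?_, fun c f => ?_⟩ (norm_nonneg F) fun f hf => ?_
    · refine hD.inj _ _ fun x => ?_
      rw [(hD.lin_vec x).map_add, hmK, hmK, hmK, ← map_add]
      congr 1
      ext T
      rw [add_apply, hK, hK, hK, (hD.lin_vec _).map_add]
    · refine hD.inj _ _ fun x => ?_
      rw [(hD.lin_vec x).map_smul, hmK, hmK, ← map_smul]
      congr 1
      ext T
      rw [smul_apply, hK, hK, (hD.lin_vec _).map_smul]
    · have hbound : ∀ x, 0 ≤ x → |pE (m F f) x| ≤ ‖F‖ * pE f x := fun x hx => by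
        have h := bidual_abs_le hA F (μ := K f x) fun T hT => by
          rw [hK]
          exact dualNonneg_of_eq hD hZ hf hx T hT
        rwa [hK, hZ.map_one, ← hmK] at h
      rw [hD.le_iff, hD.le_iff]
      constructor
      · intro x hx
        rw [(hD.lin_vec x).map_neg, (hD.lin_vec x).map_smul]
        exact (_root_.abs_le.1 (hbound x hx)).1
      · intro x hx
        rw [(hD.lin_vec x).map_smul]
        exact (_root_.abs_le.1 (hbound x hx)).2
  obtain ⟨e, he, heF⟩ := exists_unit_of_annihilator hA _ hideal
  have hπ : ∀ F, arensMul Z (arensOne Z - e) F = F - arensMul Z e F := fun F => by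
    rw [arensMul_sub_left, arensOne_mul]
  have hmπ : ∀ F, m (arensMul Z (arensOne Z - e) F) = m F := fun F => funext fun f =>
    hD.inj _ _ fun x => by
      rw [hmK, hmK, hπ]
      change F (K f x) - arensMul Z e F (K f x) = _
      rw [hideal e he F _ ⟨f, x, rfl⟩, sub_zero]
  refine ⟨arensOne Z - e, ?_, ?_, ?_⟩
  · rw [hπ, arensMul_comm hA, hπ, heF e he]
    ext μ
    change arensOne Z μ - e μ - (e μ - e μ) = arensOne Z μ - e μ
    ring
  · have hcompl : arensOne Z - (arensOne Z - e) = e := by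
      ext μ
      change arensOne Z μ - (arensOne Z μ - e μ) = e μ
      ring
    rw [hcompl]
    ext F
    rw [Set.mem_ofPred_eq, hker]
    constructor
    · exact fun h => ⟨F, heF F h⟩
    · rintro ⟨G, rfl⟩
      exact hideal e he G
  · ext S
    simp only [hmπ]
    constructor
    · intro hS
      obtain ⟨F, hF⟩ := hsurj S hS
      exact ⟨F, funext hF⟩
    · rintro ⟨F, rfl⟩
      exact hcentral F
end

section
/- Let E be a Riesz space, let J be an order ideal in E^~ that separates the points of E, and let A be a unital f-subalgebra of Z(E). Suppose E is cyclic with respect to A for the dual pair ⟨E,J⟩, i.e. there exists u∈E_+ such that the polar (Au)^0 = {0} in J. Then m(A'')|_J = Z(J): every operator in the ideal center Z(J) of J is the restriction to J of m(F) for some F in the bidual A'' of A (viewed as a subalgebra of Z(E)''), where m is the Arens homomorphism of the bidual of Z(E). -/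
open Set in
/-- A functional that is positive on a multiplicatively closed cone with order unit `1` in a real
algebra is symmetric.  By Krein–Milman it suffices to look at extreme states, which are
multiplicative. -/
theorem positive_functional_mul_comm {R : Type*} [Ring R] [Algebra ℝ R] (P : Set R)
    (hsmul : ∀ (c : ℝ), 0 ≤ c → ∀ a ∈ P, c • a ∈ P)
    (hmul : ∀ a ∈ P, ∀ b ∈ P, a * b ∈ P) (hone : (1 : R) ∈ P)
    (hunit : ∀ a : R, ∃ c : ℝ, 0 < c ∧ c • 1 - a ∈ P ∧ c • 1 + a ∈ P)
    (φ : R →ₗ[ℝ] ℝ) (hφ : ∀ a ∈ P, 0 ≤ φ a) (a b : R) : φ (a * b) = φ (b * a) := by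
  choose c hc hc1 hc2 using hunit
  have bound : ∀ ψ : R →ₗ[ℝ] ℝ, (∀ a ∈ P, 0 ≤ ψ a) → ∀ a, |ψ a| ≤ c a * ψ 1 := by
    intro ψ hψ a
    have h1 := hψ _ (hc1 a)
    have h2 := hψ _ (hc2 a)
    simp only [map_sub, map_add, map_smul, smul_eq_mul] at h1 h2
    rw [abs_le]; constructor <;> linarith
  have null : ∀ ψ : R →ₗ[ℝ] ℝ, (∀ a ∈ P, 0 ≤ ψ a) → ∀ a ∈ P, ψ a = 0 → ∀ b, ψ (a * b) = 0 := by
    intro ψ hψ a ha h0 b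
    have h1 := hψ _ (hmul a ha _ (hc1 b))
    have h2 := hψ _ (hmul a ha _ (hc2 b))
    simp only [mul_sub, mul_add, map_sub, map_add, mul_smul_comm, map_smul, smul_eq_mul, mul_one,
      h0, mul_zero] at h1 h2
    linarith
  let K : Set (R → ℝ) := {ψ | (∀ x y, ψ (x + y) = ψ x + ψ y) ∧ (∀ (t : ℝ) x, ψ (t • x) = t * ψ x) ∧
    (∀ a ∈ P, 0 ≤ ψ a) ∧ ψ 1 = 1}
  have mkK : ∀ ψ : R →ₗ[ℝ] ℝ, (∀ a ∈ P, 0 ≤ ψ a) → ψ 1 = 1 → (ψ : R → ℝ) ∈ K := fun ψ h1 h2 =>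
    ⟨fun x y => by simp, fun t x => by simp, h1, h2⟩
  have ofK : ∀ ψ ∈ K, ∃ χ : R →ₗ[ℝ] ℝ, (χ : R → ℝ) = ψ ∧ (∀ a ∈ P, 0 ≤ χ a) ∧ χ 1 = 1 :=
    fun ψ h => ⟨{ toFun := ψ, map_add' := h.1, map_smul' := by simpa using h.2.1 }, rfl, h.2.2⟩
  have hKconv : Convex ℝ K := by
    intro ψ h χ h' s t hs ht hst
    refine ⟨fun x y => ?_, fun r x => ?_, fun a ha => ?_, ?_⟩
    · simp only [Pi.add_apply, Pi.smul_apply, smul_eq_mul, h.1, h'.1]; ring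
    · simp only [Pi.add_apply, Pi.smul_apply, smul_eq_mul, h.2.1, h'.2.1]; ring
    · have := h.2.2.1 a ha
      have := h'.2.2.1 a ha
      simp only [Pi.add_apply, Pi.smul_apply, smul_eq_mul]; positivity
    · simp only [Pi.add_apply, Pi.smul_apply, smul_eq_mul, h.2.2.2, h'.2.2.2]; linarith
  have hKclosed : IsClosed K := by
    simp only [K, ofPred_and, ofPred_forall]
    refine IsClosed.inter ?_ (IsClosed.inter ?_ (IsClosed.inter ?_ ?_))
    · exact isClosed_iInter fun x => isClosed_iInter fun y => isClosed_eq (by fun_prop) (by fun_prop)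
    · exact isClosed_iInter fun x => isClosed_iInter fun y => isClosed_eq (by fun_prop) (by fun_prop)
    · exact isClosed_iInter fun x => isClosed_iInter fun y => isClosed_le (by fun_prop) (by fun_prop)
    · exact isClosed_eq (by fun_prop) (by fun_prop)
  have hKcomp : IsCompact K := by
    refine (isCompact_univ_pi fun a : R => isCompact_Icc (a := -c a) (b := c a)).of_isClosed_subset
      hKclosed ?_
    intro ψ hψ a _
    obtain ⟨χ, rfl, h1, h2⟩ := ofK ψ hψ
    have := bound χ h1 a
    rw [h2, mul_one, abs_le] at this
    exact this
  have hext : ∀ ψ ∈ K.extremePoints ℝ, ψ (a * b) = ψ a * ψ b ∧ ψ (b * a) = ψ b * ψ a := by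
    intro ψ hψ
    obtain ⟨χ, rfl, h1, h2⟩ := ofK ψ hψ.1
    have key : ∀ a ∈ P, 1 - a ∈ P → ∀ b, χ (a * b) = χ a * χ b := by
      intro a ha ha' b
      have ht0 := h1 a ha
      have ht1 := h1 _ ha'
      rw [map_sub, h2] at ht1
      rcases ht0.eq_or_lt with ht0 | ht0
      · rw [null χ h1 a ha ht0.symm, ← ht0, zero_mul]
      rcases ht1.eq_or_lt with ht1 | ht1
      · have := null χ h1 _ ha' (by rw [map_sub, h2, ← ht1]) b
        rw [sub_mul, one_mul, map_sub] at this
        rw [show χ a = 1 by linarith]; linarith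
      let χ₁ : R →ₗ[ℝ] ℝ := (χ a)⁻¹ • χ.comp (LinearMap.mulLeft ℝ a)
      let χ₂ : R →ₗ[ℝ] ℝ := (1 - χ a)⁻¹ • χ.comp (LinearMap.mulLeft ℝ (1 - a))
      have m1 : (χ₁ : R → ℝ) ∈ K := mkK _
        (fun x hx => mul_nonneg (inv_nonneg.2 ht0.le) (h1 _ (hmul a ha x hx)))
        (by simp [χ₁, ht0.ne'])
      have m2 : (χ₂ : R → ℝ) ∈ K := mkK _
        (fun x hx => mul_nonneg (inv_nonneg.2 ht1.le) (h1 _ (hmul _ ha' x hx)))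
        (by simp [χ₂, h2, ht1.ne'])
      have := (mem_extremePoints.1 hψ).2 _ m1 _ m2 ⟨χ a, 1 - χ a, ht0, ht1, by ring, ?_⟩
      · have := congrFun this.1 b
        simp only [χ₁, LinearMap.smul_apply, LinearMap.comp_apply, LinearMap.mulLeft_apply,
          smul_eq_mul] at this
        rw [← this]; field_simp
      · funext x
        simp only [χ₁, χ₂, Pi.add_apply, Pi.smul_apply, LinearMap.smul_apply, LinearMap.comp_apply,
          LinearMap.mulLeft_apply, smul_eq_mul, sub_mul, one_mul, map_sub]
        field_simp
        ring
    have full : ∀ a b, χ (a * b) = χ a * χ b := by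
      intro a b
      have hca := hc a
      have := key ((2 * c a)⁻¹ • (c a • 1 + a)) (hsmul _ (by positivity) _ (hc2 a)) ?_ b
      · simp only [smul_mul_assoc, add_mul, one_mul, map_smul, map_add, smul_eq_mul, h2] at this
        field_simp at this
        linarith
      · have e : 1 - (2 * c a)⁻¹ • (c a • (1 : R) + a) = (2 * c a)⁻¹ • (c a • 1 - a) := by
          have : (1 : R) = ((2 * c a)⁻¹ * (c a) + (2 * c a)⁻¹ * (c a)) • 1 := by
            rw [show (2 * c a)⁻¹ * (c a) + (2 * c a)⁻¹ * (c a) = 1 by field_simp; norm_num, one_smul]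
          rw [smul_add, smul_sub]
          nth_rewrite 1 [this]
          rw [add_smul, mul_smul]; abel
        rw [e]
        exact hsmul _ (by positivity) _ (hc1 a)
    exact ⟨full a b, full b a⟩
  have hsub : K ⊆ {ψ : R → ℝ | ψ (a * b) = ψ (b * a)} := by
    rw [← closure_convexHull_extremePoints hKcomp hKconv]
    refine closure_minimal (convexHull_min ?_ ?_) (isClosed_eq (by fun_prop) (by fun_prop))
    · intro ψ hψ
      rw [mem_ofPred_eq, (hext ψ hψ).1, (hext ψ hψ).2, mul_comm]
    · intro ψ h χ h' s t _ _ _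
      simp only [mem_ofPred_eq] at h h'
      simp [h, h']
  rcases (hφ 1 hone).eq_or_lt with h0 | h0
  · rw [← one_mul (a * b), ← one_mul (b * a), null φ hφ 1 hone h0.symm, null φ hφ 1 hone h0.symm]
  · have := hsub (mkK ((φ 1)⁻¹ • φ) (fun a ha => mul_nonneg (inv_nonneg.2 h0.le) (hφ a ha))
      (by simp [h0.ne']))
    simpa [h0.ne'] using this

/-- Linear maps dominated by a multiple of the identity on the positive cone. -/
def centralEnd (V : Type*) [AddCommGroup V] [PartialOrder V] [IsOrderedAddMonoid V] [Module ℝ V]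
    [PosSMulMono ℝ V] : Subalgebra ℝ (Module.End ℝ V) where
  carrier := {T | ∃ c : ℝ, 0 ≤ c ∧ ∀ x : V, 0 ≤ x → -(c • x) ≤ T x ∧ T x ≤ c • x}
  mul_mem' := by
    rintro S T ⟨c, hc0, hc⟩ ⟨d, hd0, hd⟩
    refine ⟨c * (d + d) + d * c, by positivity, fun x hx => ?_⟩
    have h1 := hc (T x + d • x) (neg_le_iff_add_nonneg.1 (hd x hx).1)
    have h3 := hc x hx
    have h4 : c • (T x + d • x) ≤ (c * (d + d)) • x := by
      rw [mul_smul, add_smul]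
      exact smul_le_smul_of_nonneg_left (add_le_add_left (hd x hx).2 _) hc0
    have e : (S * T) x = S (T x + d • x) - d • S x := by simp
    rw [e, add_smul, neg_add]
    constructor
    · rw [sub_eq_add_neg]
      refine add_le_add ((neg_le_neg h4).trans h1.1) (neg_le_neg ?_)
      rw [mul_smul]
      exact smul_le_smul_of_nonneg_left h3.2 hd0
    · rw [sub_eq_add_neg]
      refine add_le_add (h1.2.trans h4) (neg_le.1 ?_)
      rw [mul_smul, ← smul_neg]
      exact smul_le_smul_of_nonneg_left h3.1 hd0
  add_mem' := by
    rintro S T ⟨c, hc0, hc⟩ ⟨d, hd0, hd⟩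
    refine ⟨c + d, by positivity, fun x hx => ?_⟩
    rw [add_smul, neg_add]
    exact ⟨add_le_add (hc x hx).1 (hd x hx).1, add_le_add (hc x hx).2 (hd x hx).2⟩
  algebraMap_mem' := by
    intro r
    refine ⟨|r|, abs_nonneg r, fun x hx => ?_⟩
    rw [← neg_smul]
    simp only [Module.algebraMap_end_apply]
    rw [← sub_nonneg, ← sub_nonneg (b := r • x), ← sub_smul, ← sub_smul]
    exact ⟨smul_nonneg (by linarith [neg_abs_le r]) hx, smul_nonneg (by linarith [le_abs_self r]) hx⟩

theorem positive_functional_central_comm {V : Type*} [AddCommGroup V] [PartialOrder V]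
    [IsOrderedAddMonoid V] [Module ℝ V] [PosSMulMono ℝ V] {S T : Module.End ℝ V}
    (hS : S ∈ centralEnd V) (hT : T ∈ centralEnd V) (φ : V →ₗ[ℝ] ℝ)
    (hφ : ∀ x, 0 ≤ x → 0 ≤ φ x) {e : V} (he : 0 ≤ e) : φ (S (T e)) = φ (T (S e)) := by
  refine positive_functional_mul_comm (R := centralEnd V) {P | ∀ x, 0 ≤ x → 0 ≤ P.1 x} ?_ ?_ ?_ ?_
    (φ ∘ₗ LinearMap.applyₗ e ∘ₗ (centralEnd V).val.toLinearMap) ?_ ⟨S, hS⟩ ⟨T, hT⟩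
  · exact fun c hc P hP x hx => smul_nonneg hc (hP x hx)
  · exact fun P hP Q hQ x hx => hP _ (hQ x hx)
  · exact fun x hx => hx
  · rintro ⟨P, c, hc0, hc⟩
    refine ⟨c + 1, by positivity, fun x hx => ?_, fun x hx => ?_⟩
    · have := add_nonneg (sub_nonneg.2 (hc x hx).2) hx
      simpa [add_smul, sub_add_eq_add_sub] using this
    · have := add_nonneg (neg_le_iff_add_nonneg.1 (hc x hx).1) hx
      have e : (c + 1) • x + P x = P x + c • x + x := by rw [add_smul, one_smul]; abel
      simpa [e] using this
  · exact fun P hP => hφ _ (hP e he)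

theorem abs_smul_le_smul_abs {E : Type*} [Lattice E] [AddCommGroup E] [Module ℝ E]
    [PosSMulMono ℝ E] (c : ℝ) (x : E) : |c • x| ≤ |c| • |x| := by
  wlog hc : 0 ≤ c generalizing c x
  · have := this (-c) (-x) (by linarith)
    rwa [neg_smul_neg, abs_neg, abs_neg] at this
  rw [_root_.abs_of_nonneg hc]
  refine abs_le'.2 ⟨smul_le_smul_of_nonneg_left (le_abs_self x) hc, ?_⟩
  rw [← smul_neg]
  exact smul_le_smul_of_nonneg_left (neg_le_abs x) hc

section VectorLattice

variable {E : Type*} [Lattice E] [AddCommGroup E] [IsOrderedAddMonoid E]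

/-- The Riesz decomposition property for order intervals centred at the origin. -/
theorem exists_abs_le_add_eq {x y z : E} (hx : 0 ≤ x) (hy : 0 ≤ y) (hz : |z| ≤ x + y) :
    ∃ z₁ z₂, |z₁| ≤ x ∧ |z₂| ≤ y ∧ z₁ + z₂ = z := by
  obtain ⟨h1, h2⟩ := abs_le'.1 hz
  refine ⟨(z ⊓ x) ⊔ (-x), z - ((z ⊓ x) ⊔ (-x)), ?_, ?_, by abel⟩
  · exact abs_le'.2 ⟨sup_le inf_le_right (neg_le_self hx), neg_le.1 le_sup_right⟩
  · refine abs_le'.2 ⟨?_, ?_⟩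
    · rw [sub_le_comm]
      refine le_sup_of_le_left (le_inf (sub_le_self _ hy) (sub_le_iff_le_add.2 h1))
    · rw [neg_sub, sub_le_iff_le_add]
      refine sup_le (inf_le_left.trans (le_add_of_nonneg_left hy)) ?_
      have := neg_le.1 h2
      rw [neg_add] at this
      have := add_le_add_left this y
      rw [neg_add_cancel_right] at this
      rwa [add_comm] at this

variable [Module ℝ E] [PosSMulMono ℝ E]

/-- An additive and homogeneous function on the cone extends to a linear functional. -/
theorem exists_linearMap_of_cone (q : E → ℝ)
    (hadd : ∀ x y, 0 ≤ x → 0 ≤ y → q (x + y) = q x + q y)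
    (hsmul : ∀ (c : ℝ) x, 0 < c → 0 ≤ x → q (c • x) = c * q x) :
    ∃ h : E →ₗ[ℝ] ℝ, ∀ x, 0 ≤ x → h x = q x := by
  have q0 : q 0 = 0 := by simpa using hadd 0 0 le_rfl le_rfl
  have wd : ∀ x y z w, 0 ≤ x → 0 ≤ y → 0 ≤ z → 0 ≤ w → x - y = z - w → q x - q y = q z - q w := by
    intro x y z w hx hy hz hw h
    have e : x + w = z + y := by rw [sub_eq_sub_iff_add_eq_add] at h; exact h
    have := congrArg q e
    rw [hadd _ _ hx hw, hadd _ _ hz hy] at this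
    linarith
  have h2 : ∀ x y : E, 0 ≤ x → 0 ≤ y → q (x - y)⁺ - q (x - y)⁻ = q x - q y := fun x y hx hy =>
    wd _ _ _ _ (posPart_nonneg _) (negPart_nonneg _) hx hy (posPart_sub_negPart _)
  refine ⟨{ toFun := fun x => q x⁺ - q x⁻, map_add' := fun x y => ?_, map_smul' := fun c x => ?_ }, ?_⟩
  · have := h2 (x⁺ + y⁺) (x⁻ + y⁻) (add_nonneg (posPart_nonneg _) (posPart_nonneg _))
      (add_nonneg (negPart_nonneg _) (negPart_nonneg _))
    rw [add_sub_add_comm, posPart_sub_negPart, posPart_sub_negPart,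
      hadd _ _ (posPart_nonneg _) (posPart_nonneg _),
      hadd _ _ (negPart_nonneg _) (negPart_nonneg _)] at this
    rw [this]; ring
  · have hp := posPart_nonneg x
    have hn := negPart_nonneg x
    have e : c • x = c • x⁺ - c • x⁻ := by rw [← smul_sub, posPart_sub_negPart]
    simp only [RingHom.id_apply, smul_eq_mul]
    rcases lt_trichotomy c 0 with hc | rfl | hc
    · have hc' : 0 < -c := neg_pos.2 hc
      have := h2 ((-c) • x⁻) ((-c) • x⁺) (smul_nonneg hc'.le hn) (smul_nonneg hc'.le hp)
      rw [show (-c) • x⁻ - (-c) • x⁺ = c • x by rw [e, neg_smul, neg_smul]; abel,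
        hsmul _ _ hc' hn, hsmul _ _ hc' hp] at this
      rw [this]; ring
    · simp [q0]
    · have := h2 (c • x⁺) (c • x⁻) (smul_nonneg hc.le hp) (smul_nonneg hc.le hn)
      rw [← e, hsmul _ _ hc hn, hsmul _ _ hc hp] at this
      rw [this]; ring
  · intro x hx
    simp [posPart_of_nonneg hx, negPart_of_nonneg hx, q0]

open scoped Pointwise in
/-- **Riesz–Kantorovich**: the functional `x ↦ sup {g y : |y| ≤ x}` on the cone is linear. -/
theorem exists_isLUB_linearMap (g : E →ₗ[ℝ] ℝ)
    (hg : ∀ x : E, BddAbove (g '' {y | |y| ≤ x})) :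
    ∃ h : E →ₗ[ℝ] ℝ, ∀ x, 0 ≤ x → IsLUB (g '' {y | |y| ≤ x}) (h x) := by
  have hne : ∀ x : E, 0 ≤ x → (g '' {y | |y| ≤ x}).Nonempty := fun x hx => ⟨_, 0, by simpa using hx, rfl⟩
  have lub : ∀ x, 0 ≤ x → IsLUB (g '' {y | |y| ≤ x}) (sSup (g '' {y | |y| ≤ x})) := fun x hx =>
    isLUB_csSup (hne x hx) (hg x)
  suffices H : ∃ h : E →ₗ[ℝ] ℝ, ∀ x, 0 ≤ x → h x = sSup (g '' {y | |y| ≤ x}) by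
    obtain ⟨h, hh⟩ := H
    exact ⟨h, fun x hx => hh x hx ▸ lub x hx⟩
  refine exists_linearMap_of_cone _ ?_ ?_
  · intro x y hx hy
    refine (lub _ (add_nonneg hx hy)).unique ?_
    have e : g '' {z | |z| ≤ x + y} = g '' {z | |z| ≤ x} + g '' {z | |z| ≤ y} := by
      ext t
      constructor
      · rintro ⟨z, hz, rfl⟩
        obtain ⟨z₁, z₂, h1, h2, rfl⟩ := exists_abs_le_add_eq hx hy hz
        exact ⟨_, ⟨z₁, h1, rfl⟩, _, ⟨z₂, h2, rfl⟩, (map_add _ _ _).symm⟩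
      · rintro ⟨_, ⟨z₁, h1, rfl⟩, _, ⟨z₂, h2, rfl⟩, rfl⟩
        exact ⟨z₁ + z₂, (abs_add_le _ _).trans (add_le_add h1 h2), map_add _ _ _⟩
    rw [e]
    exact (lub x hx).add (lub y hy)
  · intro c x hc hx
    refine (lub _ (smul_nonneg hc.le hx)).unique ⟨?_, ?_⟩
    · rintro _ ⟨y, hy, rfl⟩
      have : g (c⁻¹ • y) ≤ sSup (g '' {y | |y| ≤ x}) := by
        refine (lub x hx).1 ⟨_, (abs_smul_le_smul_abs _ y).trans ?_, rfl⟩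
        rw [abs_of_pos (inv_pos.2 hc)]
        show c⁻¹ • |y| ≤ x
        rw [inv_smul_le_iff_of_pos hc]
        exact hy
      rw [map_smul, smul_eq_mul, inv_mul_le_iff₀ hc] at this
      exact this
    · intro b hb
      rw [← le_div_iff₀' hc]
      refine (lub x hx).2 ?_
      rintro _ ⟨y, hy, rfl⟩
      rw [le_div_iff₀' hc, ← smul_eq_mul, ← map_smul]
      refine hb ⟨_, (abs_smul_le_smul_abs _ y).trans ?_, rfl⟩
      rw [abs_of_pos hc]
      exact smul_le_smul_of_nonneg_left hy hc.le

/-- Hahn–Banach for a seminorm: a point at positive distance from a subspace is separated from it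
by a dominated functional. -/
theorem exists_linearMap_vanishing {V : Type*} [AddCommGroup V] [Module ℝ V] (q : Seminorm ℝ V)
    (p : Submodule ℝ V) (x : V) {ε : ℝ} (hε : 0 < ε) (hx : ∀ y ∈ p, ε ≤ q (x - y)) :
    ∃ (f : V →ₗ[ℝ] ℝ) (C : ℝ), 0 ≤ C ∧ (∀ y, |f y| ≤ C * q y) ∧ (∀ y ∈ p, f y = 0) ∧ f x ≠ 0 := by
  let _ : SeminormedAddCommGroup V := q.toAddGroupSeminorm.toSeminormedAddCommGroup
  let _ : NormedSpace ℝ V := ⟨fun c y => (map_smul_eq_mul q c y).le⟩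
  have hxc : x ∉ p.topologicalClosure := by
    intro h
    obtain ⟨y, hy, hd⟩ := Metric.mem_closure_iff.1 h ε hε
    rw [dist_eq_norm] at hd
    exact (hx y hy).not_gt hd
  obtain ⟨f, u, h1, h2⟩ := geometric_hahn_banach_closed_point p.topologicalClosure.convex
    p.isClosed_topologicalClosure hxc
  have h0 : ∀ y ∈ p, f y = 0 := by
    intro y hy
    by_contra hne
    have := h1 _ (p.topologicalClosure.smul_mem (u / f y) (p.le_topologicalClosure hy))
    rw [map_smul, smul_eq_mul, div_mul_cancel₀ _ hne] at this
    exact this.false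
  refine ⟨f, ‖f‖, norm_nonneg f, fun y => f.le_opNorm y, h0, ?_⟩
  have := h1 0 p.topologicalClosure.zero_mem
  rw [map_zero] at this
  exact (this.trans h2).ne'

end VectorLattice

set_option linter.unusedSectionVars false

section Duality

variable {E D : Type*} [Lattice E] [AddCommGroup E] [IsOrderedAddMonoid E] [Module ℝ E]
  [PosSMulMono ℝ E] [Lattice D] [AddCommGroup D] [IsOrderedAddMonoid D] [Module ℝ D]
  [PosSMulMono ℝ D]

theorem abs_sub_le_smul_abs {x a b : E} {c : ℝ} (ha : -(c • x⁺) ≤ a ∧ a ≤ c • x⁺)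
    (hb : -(c • x⁻) ≤ b ∧ b ≤ c • x⁻) : |a - b| ≤ c • |x| := by
  rw [← posPart_add_negPart x, smul_add]
  refine abs_le'.2 ⟨?_, ?_⟩
  · rw [sub_eq_add_neg]
    exact add_le_add ha.2 (neg_le.1 hb.1)
  · rw [neg_sub', sub_neg_eq_add]
    exact add_le_add (neg_le.1 ha.1) hb.2

namespace IsOrderDual

variable {p : D → E → ℝ} (h : IsOrderDual E D p)

include h

theorem apply_nonneg {f : D} {x : E} (hf : 0 ≤ f) (hx : 0 ≤ x) : 0 ≤ p f x := by
  have := (h.le_iff 0 f).1 hf x hx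
  rwa [(h.lin_vec x).map_zero] at this

theorem apply_mono {f : D} {x y : E} (hf : 0 ≤ f) (hxy : x ≤ y) : p f x ≤ p f y := by
  have := h.apply_nonneg hf (sub_nonneg.2 hxy)
  rw [(h.lin_fun f).map_sub] at this
  linarith

theorem abs_apply_le (f : D) (x : E) : |p f x| ≤ p |f| |x| := by
  have h1 : ∀ y, 0 ≤ y → |p f y| ≤ p |f| y := by
    intro y hy
    have h1 := (h.le_iff _ _).1 (le_abs_self f) y hy
    have h2 := (h.le_iff _ _).1 (neg_le_abs f) y hy
    rw [(h.lin_vec y).map_neg] at h2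
    exact abs_le'.2 ⟨h1, h2⟩
  have h2 := h1 _ (posPart_nonneg x)
  have h3 := h1 _ (negPart_nonneg x)
  have e : p f x = p f x⁺ - p f x⁻ := by rw [← (h.lin_fun f).map_sub, posPart_sub_negPart]
  rw [e, ← posPart_add_negPart x, (h.lin_fun _).map_add]
  exact (abs_sub _ _).trans (add_le_add h2 h3)

theorem exists_of_abs_le (φ : E →ₗ[ℝ] ℝ) {g : D} (hg : 0 ≤ g) (hφ : ∀ x, |φ x| ≤ p g |x|) :
    ∃ f : D, (∀ x, p f x = φ x) ∧ |f| ≤ g := by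
  obtain ⟨f, hf⟩ := h.surj φ φ.isLinear fun a b => ⟨-(p g (|a| ⊔ |b|)), p g (|a| ⊔ |b|), fun x hax hxb => by
    have hx : |x| ≤ |a| ⊔ |b| := abs_le'.2
      ⟨hxb.trans ((le_abs_self b).trans le_sup_right),
        (neg_le_neg hax).trans ((neg_le_abs a).trans le_sup_left)⟩
    exact _root_.abs_le.1 ((hφ x).trans (h.apply_mono hg hx))⟩
  refine ⟨f, hf, abs_le'.2 ⟨(h.le_iff _ _).2 fun x hx => ?_, (h.le_iff _ _).2 fun x hx => ?_⟩⟩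
  · have := hφ x
    rw [abs_of_nonneg hx] at this
    rw [hf]
    exact (le_abs_self _).trans this
  · have := hφ x
    rw [abs_of_nonneg hx] at this
    rw [(h.lin_vec x).map_neg, hf]
    exact (neg_le_abs _).trans this

theorem abs_apply_le_of_forall (g : D) {u : E} (hu : 0 ≤ u) {b : ℝ}
    (hb : ∀ y, |y| ≤ u → p g y ≤ b) : p |g| u ≤ b := by
  obtain ⟨k, hk⟩ := exists_isLUB_linearMap (h.lin_fun g).mk' fun x => ⟨p |g| |x|, by
    rintro _ ⟨y, hy, rfl⟩
    exact (le_abs_self _).trans ((h.abs_apply_le g y).trans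
      (h.apply_mono (abs_nonneg g) (hy.trans (le_abs_self x))))⟩
  have hk1 : ∀ x, 0 ≤ x → |p g x| ≤ k x := fun x hx =>
    abs_le'.2 ⟨(hk x hx).1 ⟨x, (abs_of_nonneg hx).le, rfl⟩,
      (hk x hx).1 ⟨-x, by simp [abs_of_nonneg hx], ((h.lin_fun g).map_neg x)⟩⟩
  have hk0 : ∀ x, 0 ≤ x → 0 ≤ k x := fun x hx => (abs_nonneg _).trans (hk1 x hx)
  obtain ⟨f, hf⟩ := h.surj k k.isLinear fun a b => ⟨k a, k b, fun x hax hxb => by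
    have h1 := hk0 _ (sub_nonneg.2 hax)
    have h2 := hk0 _ (sub_nonneg.2 hxb)
    rw [map_sub] at h1 h2
    constructor <;> linarith⟩
  have hgf : |g| ≤ f := abs_le'.2 ⟨(h.le_iff _ _).2 fun x hx => ?_, (h.le_iff _ _).2 fun x hx => ?_⟩
  · refine ((h.le_iff _ _).1 hgf u hu).trans ?_
    rw [hf]
    refine (hk u hu).2 ?_
    rintro _ ⟨y, hy, rfl⟩
    exact hb y hy
  · rw [hf]
    exact (le_abs_self _).trans (hk1 x hx)
  · rw [hf, (h.lin_vec x).map_neg]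
    exact (neg_le_abs _).trans (hk1 x hx)

/-- A subspace with trivial polar in an ideal `J` is dense for the absolute weak topology
`|σ|(E, J)`. -/
theorem exists_apply_abs_sub_lt {J : Set D} (hsolid : ∀ f ∈ J, ∀ g : D, |g| ≤ |f| → g ∈ J)
    (hsmul : ∀ (c : ℝ), ∀ f ∈ J, c • f ∈ J) (q : Submodule ℝ E)
    (hq : ∀ f ∈ J, (∀ y ∈ q, p f y = 0) → f = 0) {g : D} (hgJ : g ∈ J) (hg : 0 ≤ g) (x : E)
    {ε : ℝ} (hε : 0 < ε) : ∃ y ∈ q, p g |x - y| < ε := by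
  by_contra! hcon
  let s : Seminorm ℝ E := Seminorm.ofSMulLE (fun x => p g |x|)
    (by rw [abs_zero, (h.lin_fun g).map_zero])
    (fun x y => by rw [← (h.lin_fun g).map_add]; exact h.apply_mono hg (abs_add_le x y))
    (fun c x => by
      rw [← smul_eq_mul, ← (h.lin_fun g).map_smul]
      exact h.apply_mono hg (abs_smul_le_smul_abs c x))
  obtain ⟨φ, C, hC, hφ, hφq, hφx⟩ := exists_linearMap_vanishing s q x hε hcon
  have hCg : 0 ≤ C • g := smul_nonneg hC hg
  obtain ⟨f, hf, hfg⟩ := h.exists_of_abs_le φ hCg fun y => by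
    rw [(h.lin_vec _).map_smul]; exact hφ y
  have := hq f (hsolid _ (hsmul C g hgJ) f (hfg.trans (le_abs_self _))) fun y hy => by
    rw [hf, hφq y hy]
  rw [← hf, this, (h.lin_vec x).map_zero] at hφx
  exact hφx rfl

end IsOrderDual

namespace IsCenterOf

variable {Z : Type*} [Lattice Z] [NormedRing Z] [NormedAlgebra ℝ Z] [IsOrderedAddMonoid Z]
  [PosSMulMono ℝ Z] {ρ : Z → E → E} (hZ : IsCenterOf E Z ρ)

include hZ

theorem isLinearMap (a : Z) : IsLinearMap ℝ (ρ a) := (hZ.central a).1.1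

theorem apply_bounds (a : Z) {x : E} (hx : 0 ≤ x) : -(‖a‖ • x) ≤ ρ a x ∧ ρ a x ≤ ‖a‖ • x :=
  (hZ.norm_le_iff a ‖a‖ (norm_nonneg a)).1 le_rfl x hx

theorem apply_nonneg {a : Z} {x : E} (ha : 0 ≤ a) (hx : 0 ≤ x) : 0 ≤ ρ a x := by
  have := (hZ.le_iff 0 a).1 ha x hx
  rwa [(hZ.lin_vec x).map_zero] at this

theorem apply_mono {a : Z} {x y : E} (ha : 0 ≤ a) (hxy : x ≤ y) : ρ a x ≤ ρ a y := by
  have := hZ.apply_nonneg ha (sub_nonneg.2 hxy)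
  rwa [(hZ.isLinearMap a).map_sub, sub_nonneg] at this

theorem abs_apply_le (a : Z) (x : E) : |ρ a x| ≤ ‖a‖ • |x| := by
  have e : ρ a x = ρ a x⁺ - ρ a x⁻ := by rw [← (hZ.isLinearMap a).map_sub, posPart_sub_negPart]
  rw [e]
  exact abs_sub_le_smul_abs (hZ.apply_bounds a (posPart_nonneg x))
    (hZ.apply_bounds a (negPart_nonneg x))

theorem mem_centralEnd (a : Z) : (hZ.isLinearMap a).mk' ∈ centralEnd E :=
  ⟨‖a‖, norm_nonneg a, fun _ hx => hZ.apply_bounds a hx⟩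

theorem mul_eq_zero_of_inf_eq_zero {a b : Z} (ha : 0 ≤ a) (hb : 0 ≤ b) (hab : a ⊓ b = 0) :
    a * b = 0 := by
  refine le_antisymm ?_ ?_
  · have hc : 0 < ‖a‖ + ‖b‖ + 1 := by positivity
    have h1 : (‖a‖ + ‖b‖ + 1)⁻¹ • (a * b) ≤ a ⊓ b := by
      refine le_inf ?_ ?_ <;> rw [inv_smul_le_iff_of_pos hc, hZ.le_iff] <;> intro x hx <;>
        rw [hZ.map_mul, (hZ.lin_vec x).map_smul]
      · rw [← (hZ.isLinearMap a).map_smul]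
        refine hZ.apply_mono ha ((hZ.apply_bounds b hx).2.trans ?_)
        rw [← sub_nonneg, ← sub_smul]
        exact smul_nonneg (by linarith [norm_nonneg a]) hx
      · have hbx := hZ.apply_nonneg hb hx
        refine (hZ.apply_bounds a hbx).2.trans ?_
        rw [← sub_nonneg, ← sub_smul]
        exact smul_nonneg (by linarith [norm_nonneg b]) hbx
    rwa [hab, inv_smul_le_iff_of_pos hc, smul_zero] at h1
  · rw [hZ.le_iff]
    intro x hx
    rw [hZ.map_mul, (hZ.lin_vec x).map_zero]
    exact hZ.apply_nonneg ha (hZ.apply_nonneg hb hx)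

/-- In an Archimedean space, the kernel of a positive central operator is disjoint from its
range. -/
theorem eq_zero_of_apply_eq_zero (harch : ∀ v x : E, 0 ≤ v → (∀ t : ℝ, 0 < t → v ≤ t • x) → v = 0)
    {a : Z} (ha : 0 ≤ a) {v x : E} (hx : 0 ≤ x) (hv : 0 ≤ v) (hvx : v ≤ ρ a x) (hav : ρ a v = 0) :
    v = 0 := by
  refine harch v x hv fun t ht => ?_
  have hr : 0 ≤ (v - t • x)⁻ := negPart_nonneg _
  have hs : 0 ≤ (v - t • x)⁺ := posPart_nonneg _
  have hk : 0 < ‖a‖ + t := by positivity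
  have hsv : (v - t • x)⁺ ≤ v := sup_le (sub_le_self _ (smul_nonneg ht.le hx)) hv
  have h1 : t • ρ a x ≤ ρ a (v - t • x)⁻ := by
    have := hZ.apply_mono ha (neg_le_negPart (v - t • x))
    rwa [neg_sub, (hZ.isLinearMap a).map_sub, hav, sub_zero, (hZ.isLinearMap a).map_smul] at this
  have h2 : (‖a‖ + t)⁻¹ • t • (v - t • x)⁺ ≤ (v - t • x)⁺ ⊓ (v - t • x)⁻ := by
    refine le_inf ?_ ?_ <;> rw [inv_smul_le_iff_of_pos hk, add_smul]
    · exact le_add_of_nonneg_left (smul_nonneg (norm_nonneg a) hs)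
    · refine le_add_of_le_of_nonneg ?_ (smul_nonneg ht.le hr)
      exact (smul_le_smul_of_nonneg_left (hsv.trans hvx) ht.le).trans
        (h1.trans (hZ.apply_bounds a hr).2)
  rw [posPart_inf_negPart_eq_zero, inv_smul_le_iff_of_pos hk, smul_zero] at h2
  exact sub_nonpos.1 ((le_posPart _).trans ((smul_nonpos_iff_nonpos_of_pos_left ht).1 h2))

theorem sup_zero_apply (harch : ∀ v x : E, 0 ≤ v → (∀ t : ℝ, 0 < t → v ≤ t • x) → v = 0)
    (a : Z) {x : E} (hx : 0 ≤ x) : ρ (a ⊔ 0) x = ρ a x ⊔ 0 := by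
  have hp : 0 ≤ a⁺ := posPart_nonneg a
  have hn : 0 ≤ a⁻ := negPart_nonneg a
  have hpn : a⁺ ⊓ a⁻ = 0 := posPart_inf_negPart_eq_zero a
  have hnp : a⁻ ⊓ a⁺ = 0 := by rw [inf_comm, hpn]
  have hpx := hZ.apply_nonneg hp hx
  have hnx := hZ.apply_nonneg hn hx
  have hv : 0 ≤ ρ a⁺ x ⊓ ρ a⁻ x := le_inf hpx hnx
  have h0 : ρ a⁺ x ⊓ ρ a⁻ x = 0 := by
    refine hZ.eq_zero_of_apply_eq_zero harch hp hx hv inf_le_left (le_antisymm ?_ ?_)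
    · refine (hZ.apply_mono hp inf_le_right).trans ?_
      rw [← hZ.map_mul, hZ.mul_eq_zero_of_inf_eq_zero hp hn hpn, (hZ.lin_vec x).map_zero]
    · exact hZ.apply_nonneg hp hv
  have e : ρ a x = ρ a⁺ x - ρ a⁻ x := by rw [← (hZ.lin_vec x).map_sub, posPart_sub_negPart]
  have h1 : ρ a⁺ x - ρ a⁺ x ⊓ ρ a⁻ x = _ := sub_inf _ _ _
  rw [h0, sub_zero, sub_self, sup_comm] at h1
  rw [← posPart_def, e]
  exact h1

theorem sup_apply (harch : ∀ v x : E, 0 ≤ v → (∀ t : ℝ, 0 < t → v ≤ t • x) → v = 0)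
    (a b : Z) {x : E} (hx : 0 ≤ x) : ρ (a ⊔ b) x = ρ a x ⊔ ρ b x := by
  have h1 : a ⊔ b = (a - b) ⊔ 0 + b := by rw [sup_add, sub_add_cancel, zero_add]
  rw [h1, (hZ.lin_vec x).map_add, hZ.sup_zero_apply harch _ hx, sup_add,
    (hZ.lin_vec x).map_sub, sub_add_cancel, zero_add]

theorem neg_apply (a : Z) (x : E) : ρ (-a) x = -ρ a x := (hZ.lin_vec x).map_neg a

theorem inf_apply (harch : ∀ v x : E, 0 ≤ v → (∀ t : ℝ, 0 < t → v ≤ t • x) → v = 0)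
    (a b : Z) {x : E} (hx : 0 ≤ x) : ρ (a ⊓ b) x = ρ a x ⊓ ρ b x := by
  rw [← neg_neg (a ⊓ b), neg_inf, hZ.neg_apply, hZ.sup_apply harch _ _ hx, hZ.neg_apply,
    hZ.neg_apply, neg_sup, neg_neg, neg_neg]

end IsCenterOf

end Duality

theorem exists_continuousLinearMap_comp_eq {V W : Type*} [AddCommGroup V] [Module ℝ V]
    [SeminormedAddCommGroup W] [NormedSpace ℝ W] (R : V →ₗ[ℝ] W) (hR : Function.Injective R)
    (φ : V →ₗ[ℝ] ℝ) {c : ℝ} (hφ : ∀ v, |φ v| ≤ c * ‖R v‖) :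
    ∃ G : W →L[ℝ] ℝ, ∀ v, G (R v) = φ v := by
  let e := LinearEquiv.ofInjective R hR
  let ψ : LinearMap.range R →L[ℝ] ℝ := (φ ∘ₗ e.symm.toLinearMap).mkContinuous c fun y => by
    obtain ⟨v, rfl⟩ := e.surjective y
    rw [LinearMap.comp_apply, LinearEquiv.coe_coe, LinearEquiv.symm_apply_apply]
    exact hφ v
  obtain ⟨G, hG, -⟩ := exists_extension_norm_eq (LinearMap.range R) ψ
  refine ⟨G, fun v => (hG (e v)).trans ?_⟩
  change φ (e.symm (e v)) = φ v
  rw [LinearEquiv.symm_apply_apply]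

theorem isOrderedAddMonoid_of_covariantClass (V : Type*) [AddCommGroup V] [PartialOrder V]
    [CovariantClass V V (· + ·) (· ≤ ·)] : IsOrderedAddMonoid V where
  add_le_add_left _ _ hab c := by
    simpa only [add_comm _ c] using CovariantClass.elim c hab

section Arens

variable {E D Z : Type*} [Lattice E] [AddCommGroup E] [IsOrderedAddMonoid E] [Module ℝ E]
  [PosSMulMono ℝ E] [Lattice D] [AddCommGroup D] [IsOrderedAddMonoid D] [Module ℝ D]
  [PosSMulMono ℝ D] [Lattice Z] [NormedRing Z] [NormedAlgebra ℝ Z] [IsOrderedAddMonoid Z]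
  [PosSMulMono ℝ Z] {p : D → E → ℝ} {ρ : Z → E → E} {J : Submodule ℝ D}

instance Submodule.instPosSMulMono : PosSMulMono ℝ J :=
  ⟨fun _ hc _ _ hfg => smul_le_smul_of_nonneg_left (α := ℝ) (β := D) hfg hc⟩

theorem posPart_mem_of_solid (hsolid : ∀ f ∈ J, ∀ g : D, |g| ≤ |f| → g ∈ J) {f : D} (hf : f ∈ J) :
    f⁺ ∈ J := by
  refine hsolid f hf _ ?_
  rw [abs_of_nonneg (posPart_nonneg f), ← posPart_add_negPart f]
  exact le_add_of_nonneg_right (negPart_nonneg f)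

theorem negPart_mem_of_solid (hsolid : ∀ f ∈ J, ∀ g : D, |g| ≤ |f| → g ∈ J) {f : D} (hf : f ∈ J) :
    f⁻ ∈ J := by
  rw [← posPart_neg]
  exact posPart_mem_of_solid hsolid (J.neg_mem hf)

theorem abs_mem_of_solid (hsolid : ∀ f ∈ J, ∀ g : D, |g| ≤ |f| → g ∈ J) {f : D} (hf : f ∈ J) :
    |f| ∈ J :=
  hsolid f hf _ (abs_abs f).le

/-- A space whose points are separated by an ideal of its order dual is Archimedean. -/
theorem IsOrderDual.eq_zero_of_forall_le_smul (h : IsOrderDual E D p)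
    (hsep : ∀ x : E, (∀ f ∈ J, p f x = 0) → x = 0) (v x : E) (hv : 0 ≤ v)
    (hvx : ∀ t : ℝ, 0 < t → v ≤ t • x) : v = 0 := by
  have hpos : ∀ f : D, 0 ≤ f → p f v = 0 := by
    intro f hf
    refine le_antisymm (le_of_forall_pos_lt_add fun ε hε => ?_) (h.apply_nonneg hf hv)
    have hk : 0 < |p f x| + 1 := by positivity
    have h1 := h.apply_mono hf (hvx (ε / (|p f x| + 1)) (by positivity))
    rw [(h.lin_fun f).map_smul, smul_eq_mul] at h1
    have h2 : ε / (|p f x| + 1) * p f x < ε := by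
      rw [div_mul_eq_mul_div, div_lt_iff₀ hk]
      nlinarith [le_abs_self (p f x)]
    linarith
  refine hsep v fun f _ => ?_
  rw [← posPart_sub_negPart f, (h.lin_vec v).map_sub, hpos _ (posPart_nonneg f),
    hpos _ (negPart_nonneg f), sub_zero]

theorem IsCentralOn.exists_abs_apply_le (hsolid : ∀ f ∈ J, ∀ g : D, |g| ≤ |f| → g ∈ J)
    {S : D → D} (hS : IsCentralOn (J : Set D) S) :
    ∃ c : ℝ, 0 ≤ c ∧ ∀ f ∈ J, |S f| ≤ c • |f| := by
  obtain ⟨-, hadd, hsmul, c, hc⟩ := hS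
  refine ⟨|c|, abs_nonneg c, fun f hf => ?_⟩
  have hc' : ∀ g ∈ J, 0 ≤ g → -(|c| • g) ≤ S g ∧ S g ≤ |c| • g := fun g hg hg0 => by
    have h1 : c • g ≤ |c| • g := by
      rw [← sub_nonneg, ← sub_smul]
      exact smul_nonneg (sub_nonneg.2 (le_abs_self c)) hg0
    exact ⟨(neg_le_neg h1).trans (hc g hg hg0).1, (hc g hg hg0).2.trans h1⟩
  have hp := posPart_mem_of_solid hsolid hf
  have hn := negPart_mem_of_solid hsolid hf
  have e : S f = S f⁺ - S f⁻ := by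
    rw [eq_sub_iff_add_eq, ← hadd f hf _ hn, ← sub_eq_iff_eq_add.1 (posPart_sub_negPart f)]
  rw [e]
  exact abs_sub_le_smul_abs (hc' _ hp (posPart_nonneg f)) (hc' _ hn (negPart_nonneg f))

/-- The operator on the ideal `J` encoded by `S`. -/
def IsCentralOn.toEnd {S : D → D} (hS : IsCentralOn (J : Set D) S) : Module.End ℝ J where
  toFun f := ⟨S f, hS.1 f f.2⟩
  map_add' f g := Subtype.ext (hS.2.1 f f.2 g g.2)
  map_smul' c f := Subtype.ext (hS.2.2.1 c f f.2)

theorem IsCentralOn.toEnd_mem_centralEnd (hsolid : ∀ f ∈ J, ∀ g : D, |g| ≤ |f| → g ∈ J)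
    {S : D → D} (hS : IsCentralOn (J : Set D) S) : hS.toEnd ∈ centralEnd J := by
  obtain ⟨c, hc, hcS⟩ := hS.exists_abs_apply_le hsolid
  refine ⟨c, hc, fun f hf => ?_⟩
  have h1 := hcS f f.2
  rw [abs_of_nonneg (show (0 : D) ≤ f from hf)] at h1
  exact ⟨neg_le.1 (abs_le'.1 h1).2, (abs_le'.1 h1).1⟩

theorem IsOrderDual.apply_central_comm (h : IsOrderDual E D p)
    (hsolid : ∀ f ∈ J, ∀ g : D, |g| ≤ |f| → g ∈ J) {S T : D → D}
    (hS : IsCentralOn (J : Set D) S) (hT : IsCentralOn (J : Set D) T) {u : E} (hu : 0 ≤ u)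
    {f : D} (hf : f ∈ J) : p (S (T f)) u = p (T (S f)) u := by
  have key : ∀ g : J, 0 ≤ g → p (S (T g)) u = p (T (S g)) u := fun g hg =>
    positive_functional_central_comm (hS.toEnd_mem_centralEnd hsolid)
      (hT.toEnd_mem_centralEnd hsolid) ((h.lin_vec u).mk' ∘ₗ J.subtype)
      (fun g hg => h.apply_nonneg hg hu) hg
  have e : ∀ {S T : D → D} (hS : IsCentralOn (J : Set D) S) (hT : IsCentralOn (J : Set D) T),
      p (S (T f)) u = p (S (T f⁺)) u - p (S (T f⁻)) u := by
    intro S T hS hT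
    have hfe : (⟨f, hf⟩ : J) = ⟨f⁺, posPart_mem_of_solid hsolid hf⟩ -
        ⟨f⁻, negPart_mem_of_solid hsolid hf⟩ := Subtype.ext (posPart_sub_negPart f).symm
    have := congrArg (((h.lin_vec u).mk' ∘ₗ J.subtype) ∘ₗ hS.toEnd ∘ₗ hT.toEnd) hfe
    rw [map_sub] at this
    exact this
  rw [e hS hT, e hT hS, key ⟨_, posPart_mem_of_solid hsolid hf⟩ (posPart_nonneg f),
    key ⟨_, negPart_mem_of_solid hsolid hf⟩ (negPart_nonneg f)]

theorem IsOrderDual.apply_center_comm (h : IsOrderDual E D p) (hZ : IsCenterOf E Z ρ) (a b : Z)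
    {u : E} (hu : 0 ≤ u) (f : D) : p f (ρ a (ρ b u)) = p f (ρ b (ρ a u)) := by
  have key : ∀ g : D, 0 ≤ g → p g (ρ a (ρ b u)) = p g (ρ b (ρ a u)) := fun g hg =>
    positive_functional_central_comm (hZ.mem_centralEnd a) (hZ.mem_centralEnd b)
      (h.lin_fun g).mk' (fun x hx => h.apply_nonneg hg hx) hu
  rw [← posPart_sub_negPart f, (h.lin_vec _).map_sub, (h.lin_vec _).map_sub,
    key _ (posPart_nonneg f), key _ (negPart_nonneg f)]

theorem IsOrderDual.abs_apply_center_le (h : IsOrderDual E D p) (hZ : IsCenterOf E Z ρ) (f : D)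
    (x : E) (a : Z) : |p f (ρ a x)| ≤ p |f| |x| * ‖a‖ := by
  refine (h.abs_apply_le _ _).trans ((h.apply_mono (abs_nonneg f) (hZ.abs_apply_le a x)).trans ?_)
  rw [(h.lin_fun _).map_smul, smul_eq_mul, mul_comm]

/-- The functional `μ_{x,f}`, `T ↦ f (T x)`, on the center. -/
noncomputable def centerFunctional (h : IsOrderDual E D p) (hZ : IsCenterOf E Z ρ) (f : D) (x : E) :
    Z →L[ℝ] ℝ :=
  ((h.lin_fun f).mk' ∘ₗ (hZ.lin_vec x).mk').mkContinuous (p |f| |x|)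
    fun a => h.abs_apply_center_le hZ f x a

section

variable (h : IsOrderDual E D p) (hZ : IsCenterOf E Z ρ)

theorem centerFunctional_apply (f : D) (x : E) (a : Z) :
    centerFunctional h hZ f x a = p f (ρ a x) := rfl

theorem norm_centerFunctional_le (f : D) (x : E) : ‖centerFunctional h hZ f x‖ ≤ p |f| |x| :=
  LinearMap.mkContinuous_norm_le _ (h.apply_nonneg (abs_nonneg f) (abs_nonneg x)) _

theorem centerFunctional_add_left (f g : D) (x : E) :
    centerFunctional h hZ (f + g) x = centerFunctional h hZ f x + centerFunctional h hZ g x :=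
  ContinuousLinearMap.ext fun a => (h.lin_vec (ρ a x)).map_add f g

theorem centerFunctional_smul_left (c : ℝ) (f : D) (x : E) :
    centerFunctional h hZ (c • f) x = c • centerFunctional h hZ f x :=
  ContinuousLinearMap.ext fun a => (h.lin_vec (ρ a x)).map_smul c f

theorem centerFunctional_sub_right (f : D) (x y : E) :
    centerFunctional h hZ f (x - y) = centerFunctional h hZ f x - centerFunctional h hZ f y :=
  ContinuousLinearMap.ext fun a => by
    simp [centerFunctional_apply, (hZ.isLinearMap a).map_sub, (h.lin_fun f).map_sub]

include h hZ in
/-- Every `m F` restricts to a central operator on every ideal of the order dual. -/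
theorem isCentralOn_arens (hsolid : ∀ f ∈ J, ∀ g : D, |g| ≤ |f| → g ∈ J)
    {m : ((Z →L[ℝ] ℝ) →L[ℝ] ℝ) → D → D}
    (hm : ∀ F f x, p (m F f) x = F (centerFunctional h hZ f x)) (F : (Z →L[ℝ] ℝ) →L[ℝ] ℝ) :
    IsCentralOn (J : Set D) (m F) := by
  have hadd : ∀ f g, m F (f + g) = m F f + m F g := fun f g => h.inj _ _ fun x => by
    rw [(h.lin_vec x).map_add, hm, hm, hm, centerFunctional_add_left, map_add]
  have hsmul : ∀ (c : ℝ) f, m F (c • f) = c • m F f := fun c f => h.inj _ _ fun x => by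
    rw [(h.lin_vec x).map_smul, hm, hm, centerFunctional_smul_left, map_smul]
  have hbound : ∀ f, |m F f| ≤ ‖F‖ • |f| := fun f => by
    have h1 : ∀ x, 0 ≤ x → |p (m F f) x| ≤ p (‖F‖ • |f|) x := fun x hx => by
      rw [hm, (h.lin_vec x).map_smul, smul_eq_mul]
      have := norm_centerFunctional_le h hZ f x
      rw [abs_of_nonneg hx] at this
      exact (F.le_opNorm _).trans (mul_le_mul_of_nonneg_left this (norm_nonneg F))
    refine abs_le'.2 ⟨(h.le_iff _ _).2 fun x hx => (le_abs_self _).trans (h1 x hx),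
      (h.le_iff _ _).2 fun x hx => ?_⟩
    rw [(h.lin_vec x).map_neg]
    exact (neg_le_abs _).trans (h1 x hx)
  refine ⟨fun f hf => ?_, fun f _ g _ => hadd f g, fun c f _ => hsmul c f, ‖F‖, fun f _ hf => ?_⟩
  · exact hsolid _ (J.smul_mem ‖F‖ (abs_mem_of_solid hsolid hf)) _
      ((hbound f).trans (le_abs_self _))
  · have := hbound f
    rw [abs_of_nonneg hf] at this
    exact ⟨neg_le.1 (abs_le'.1 this).2, (abs_le'.1 this).1⟩

include h hZ in
theorem apply_abs_le_of_cyclic (hsep : ∀ x : E, (∀ f ∈ J, p f x = 0) → x = 0) {A : Subalgebra ℝ Z}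
    (hAlat : ∀ a ∈ A, ∀ b ∈ A, a ⊔ b ∈ A) {u : E} (hu : 0 ≤ u)
    (hdense : ∀ f ∈ J, ∀ x : E, ∀ ε : ℝ, 0 < ε → ∃ a ∈ A, p |f| |x - ρ a u| < ε)
    {g : D} (hg : g ∈ J) {M : ℝ} (hM : ∀ a ∈ A, ‖a‖ ≤ 1 → p g (ρ a u) ≤ M) :
    p |g| u ≤ M := by
  have harch := h.eq_zero_of_forall_le_smul hsep
  refine h.abs_apply_le_of_forall g hu fun y hy => le_of_forall_pos_le_add fun ε hε => ?_
  obtain ⟨a, haA, ha⟩ := hdense g hg y ε hε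
  have hbA : (a ⊓ 1) ⊔ (-1) ∈ A := by
    refine hAlat _ ?_ _ (A.neg_mem A.one_mem)
    rw [← neg_neg (a ⊓ 1), neg_inf]
    exact A.neg_mem (hAlat _ (A.neg_mem haA) _ (A.neg_mem A.one_mem))
  have hbx : ∀ x, 0 ≤ x → ρ ((a ⊓ 1) ⊔ (-1)) x = (ρ a x ⊓ x) ⊔ (-x) := fun x hx => by
    rw [hZ.sup_apply harch _ _ hx, hZ.inf_apply harch _ _ hx, hZ.neg_apply, hZ.map_one]
  have hb1 : ‖(a ⊓ 1) ⊔ (-1)‖ ≤ 1 := by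
    rw [hZ.norm_le_iff _ _ zero_le_one]
    intro x hx
    rw [hbx x hx, one_smul]
    exact ⟨le_sup_right, sup_le inf_le_right (neg_le_self hx)⟩
  have hyu : y = (y ⊓ u) ⊔ (-u) := by
    rw [inf_eq_left.2 ((le_abs_self y).trans hy), sup_eq_left.2 (neg_le.1 ((neg_le_abs y).trans hy))]
  have hyb : |y - ρ ((a ⊓ 1) ⊔ (-1)) u| ≤ |y - ρ a u| := by
    rw [hbx u hu]
    conv_lhs => rw [hyu]
    exact (abs_sup_sub_sup_le_abs _ _ _).trans (abs_inf_sub_inf_le_abs _ _ _)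
  have h1 := (h.abs_apply_le g (y - ρ ((a ⊓ 1) ⊔ (-1)) u)).trans
    (h.apply_mono (abs_nonneg g) hyb)
  have h2 := hM _ hbA hb1
  rw [(h.lin_fun g).map_sub] at h1
  linarith [le_abs_self (p g y - p g (ρ ((a ⊓ 1) ⊔ (-1)) u))]

include h hZ in
/-- Every central operator on `J` is induced by an element of the bipolar of `A`. -/
theorem exists_arens_eq_of_isCentralOn (hsolid : ∀ f ∈ J, ∀ g : D, |g| ≤ |f| → g ∈ J)
    (hsep : ∀ x : E, (∀ f ∈ J, p f x = 0) → x = 0) {A : Subalgebra ℝ Z}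
    (hAlat : ∀ a ∈ A, ∀ b ∈ A, a ⊔ b ∈ A) {u : E} (hu : 0 ≤ u)
    (hcyc : ∀ f ∈ J, (∀ a ∈ A, p f (ρ a u) = 0) → f = 0)
    {m : ((Z →L[ℝ] ℝ) →L[ℝ] ℝ) → D → D}
    (hm : ∀ F f x, p (m F f) x = F (centerFunctional h hZ f x)) {S : D → D}
    (hS : IsCentralOn (J : Set D) S) :
    ∃ F : (Z →L[ℝ] ℝ) →L[ℝ] ℝ,
      (∀ μ : Z →L[ℝ] ℝ, (∀ a ∈ A, μ a = 0) → F μ = 0) ∧ ∀ f ∈ J, m F f = S f := by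
  have hdense : ∀ f ∈ J, ∀ x : E, ∀ ε : ℝ, 0 < ε → ∃ a ∈ A, p |f| |x - ρ a u| < ε := by
    intro f hf x ε hε
    obtain ⟨y, hy, hyx⟩ := h.exists_apply_abs_sub_lt (J := (J : Set D)) hsolid
      (fun c f hf => J.smul_mem c hf)
      ((Subalgebra.toSubmodule A).map (hZ.lin_vec u).mk')
      (fun f hf hfq => hcyc f hf fun a ha => hfq _ ⟨a, ha, rfl⟩)
      (abs_mem_of_solid hsolid hf) (abs_nonneg f) x hε
    obtain ⟨a, ha, rfl⟩ := hy
    exact ⟨a, ha, hyx⟩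
  obtain ⟨c, hc, hcS⟩ := hS.exists_abs_apply_le hsolid
  have hcSp : ∀ f ∈ J, ∀ x, |p (S f) x| ≤ c * p |f| |x| := fun f hf x => by
    refine (h.abs_apply_le _ _).trans (((h.le_iff _ _).1 (hcS f hf) _ (abs_nonneg x)).trans ?_)
    rw [(h.lin_vec _).map_smul, smul_eq_mul]
  obtain ⟨q, hq⟩ : ∃ q : Submodule ℝ Z, ∀ a, a ∈ q ↔ a ∈ A :=
    ⟨Subalgebra.toSubmodule A, fun _ => Iff.rfl⟩
  let ι : q →L[ℝ] Z := q.subtypeL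
  let R : J →ₗ[ℝ] (q →L[ℝ] ℝ) :=
    { toFun := fun g => (centerFunctional h hZ (g : D) u).comp ι
      map_add' := fun f g => by
        ext a
        exact (h.lin_vec _).map_add _ _
      map_smul' := fun c f => by
        ext a
        exact (h.lin_vec _).map_smul _ _ }
  have hR : ∀ (g : J) (a : q), R g a = p g (ρ a u) := fun _ _ => rfl
  have hRinj : Function.Injective R := by
    rw [injective_iff_map_eq_zero]
    intro g hg
    refine Subtype.ext (hcyc g g.2 fun a ha => ?_)
    rw [← hR g ⟨a, (hq a).2 ha⟩, hg]
    rfl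
  have hRnorm : ∀ g : J, p |(g : D)| u ≤ ‖R g‖ := fun g =>
    apply_abs_le_of_cyclic h hZ hsep hAlat hu hdense g.2 fun a ha ha1 => by
      have h1 := (R g).le_opNorm ⟨a, (hq a).2 ha⟩
      rw [hR] at h1
      refine (le_abs_self _).trans (h1.trans (mul_le_of_le_one_right (norm_nonneg _) ha1))
  obtain ⟨G, hGR⟩ := exists_continuousLinearMap_comp_eq (V := J) (W := q →L[ℝ] ℝ) R hRinj
    ((h.lin_vec u).mk' ∘ₗ J.subtype ∘ₗ hS.toEnd) (c := c) fun g => by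
      have h1 := hcSp g g.2 u
      rw [abs_of_nonneg hu] at h1
      exact h1.trans (mul_le_mul_of_nonneg_left (hRnorm g) hc)
  replace hGR : ∀ g : J, G (R g) = p (S g) u := hGR
  let F : (Z →L[ℝ] ℝ) →L[ℝ] ℝ :=
    G.comp ((ContinuousLinearMap.compL ℝ q Z ℝ).flip ι)
  have hF : ∀ μ, F μ = G (μ.comp ι) := fun _ => rfl
  have hev : ∀ a : Z, IsCentralOn (J : Set D) (m (ContinuousLinearMap.apply ℝ ℝ a)) := fun a =>
    isCentralOn_arens h hZ hsolid hm _
  have hevp : ∀ (a : Z) (f : D) (x : E),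
      p (m (ContinuousLinearMap.apply ℝ ℝ a) f) x = p f (ρ a x) := fun a f x => hm _ f x
  have hFu : ∀ f ∈ J, ∀ a : Z, F (centerFunctional h hZ f (ρ a u)) = p (S f) (ρ a u) := by
    intro f hf a
    have h1 : (centerFunctional h hZ f (ρ a u)).comp ι = R ⟨_, (hev a).1 f hf⟩ := by
      ext b
      rw [hR, hevp]
      exact h.apply_center_comm hZ b a hu f
    rw [hF, h1, hGR, ← hevp a (S f) u]
    exact h.apply_central_comm hsolid hS (hev a) hu hf
  refine ⟨F, fun μ hμ => ?_, fun f hf => h.inj _ _ fun x => ?_⟩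
  · have : μ.comp ι = 0 := by
      ext a
      exact hμ a ((hq a).1 a.2)
    rw [hF, this, map_zero]
  · rw [hm, ← sub_eq_zero, ← abs_nonpos_iff]
    refine le_of_forall_pos_le_add fun ε hε => ?_
    have hk : 0 < ‖F‖ + c + 1 := by positivity
    obtain ⟨a, -, ha⟩ := hdense f hf x (ε / (‖F‖ + c + 1)) (by positivity)
    have h1 : |F (centerFunctional h hZ f (x - ρ a u))| ≤ ‖F‖ * p |f| |x - ρ a u| :=
      (F.le_opNorm _).trans
        (mul_le_mul_of_nonneg_left (norm_centerFunctional_le h hZ _ _) (norm_nonneg F))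
    have h2 := hcSp f hf (x - ρ a u)
    have h3 : F (centerFunctional h hZ f x) - p (S f) x =
        F (centerFunctional h hZ f (x - ρ a u)) - p (S f) (x - ρ a u) := by
      rw [centerFunctional_sub_right, map_sub, hFu f hf, (h.lin_fun _).map_sub]
      ring
    have h4 : 0 ≤ p |f| |x - ρ a u| := h.apply_nonneg (abs_nonneg f) (abs_nonneg _)
    rw [lt_div_iff₀ hk] at ha
    rw [h3, zero_add]
    refine (abs_sub _ _).trans ?_
    nlinarith

end

end Arens

/-- Lemma 3.  Let `E` be a Riesz space, `J` an order ideal in `E^∼`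
(realized as a solid subspace of `D`) separating the points of `E`, and `A` a unital
`f`-subalgebra of `Z(E)` (a unital subalgebra that is a sublattice).  Suppose `E` is
cyclic with respect to `A` for the dual pair `⟨E,J⟩`: there is `u ∈ E₊` with
`(Au)⁰ = {0}` in `J`.  Then `m(A'')|_J = Z(J)`: identifying `A''` with the bipolar
`A⁰⁰ ⊆ Z(E)''`, the restrictions to `J` of the operators `m(F)`, `F ∈ A⁰⁰`, are exactly
the operators of the ideal center `Z(J)` of `J`. -/
theorem statement11
    {E D Z : Type*}
    [Lattice E] [AddCommGroup E] [Module ℝ E]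
    [CovariantClass E E (· + ·) (· ≤ ·)] [PosSMulMono ℝ E]
    [Lattice D] [AddCommGroup D] [Module ℝ D]
    [CovariantClass D D (· + ·) (· ≤ ·)] [PosSMulMono ℝ D]
    [Lattice Z] [NormedRing Z] [NormedAlgebra ℝ Z]
    [CovariantClass Z Z (· + ·) (· ≤ ·)] [PosSMulMono ℝ Z]
    (pE : D → E → ℝ) (hD : IsOrderDual E D pE)
    (ρ : Z → E → E) (hZ : IsCenterOf E Z ρ)
    -- `J` is an order ideal in `E^∼`:
    (J : Set D)
    (hJadd : ∀ f ∈ J, ∀ g ∈ J, f + g ∈ J)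
    (hJsmul : ∀ (c : ℝ), ∀ f ∈ J, c • f ∈ J)
    (hJsolid : ∀ f ∈ J, ∀ g : D, |g| ≤ |f| → g ∈ J)
    -- `J` separates the points of `E`:
    (hJsep : ∀ x : E, (∀ f ∈ J, pE f x = 0) → x = 0)
    -- `A` is a unital `f`-subalgebra of `Z(E)`:
    (A : Subalgebra ℝ Z) (hAlat : ∀ a ∈ A, ∀ b ∈ A, a ⊔ b ∈ A)
    -- `E` is cyclic with respect to `A` for `⟨E,J⟩`:
    (hcyc : ∃ u : E, 0 ≤ u ∧ ∀ f ∈ J, (∀ a : Z, a ∈ A → pE f (ρ a u) = 0) → f = 0)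
    -- the Arens homomorphism `m : Z(E)'' → Z(E^∼)`:
    (m : ((Z →L[ℝ] ℝ) →L[ℝ] ℝ) → D → D)
    (hm : ∀ (F : (Z →L[ℝ] ℝ) →L[ℝ] ℝ) (f : D) (x : E) (μ : Z →L[ℝ] ℝ),
      (∀ T : Z, μ T = pE f (ρ T x)) → pE (m F f) x = F μ) :
    -- `m(A'')|_J ⊆ Z(J)` …
    (∀ F : (Z →L[ℝ] ℝ) →L[ℝ] ℝ,
      (∀ μ : Z →L[ℝ] ℝ, (∀ a ∈ A, μ a = 0) → F μ = 0) → IsCentralOn J (m F)) ∧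
    -- … and every operator in `Z(J)` is the restriction to `J` of some `m(F)`, `F ∈ A⁰⁰`:
    (∀ S : D → D, IsCentralOn J S →
      ∃ F : (Z →L[ℝ] ℝ) →L[ℝ] ℝ,
        (∀ μ : Z →L[ℝ] ℝ, (∀ a ∈ A, μ a = 0) → F μ = 0) ∧ ∀ f ∈ J, m F f = S f) := by
  have := isOrderedAddMonoid_of_covariantClass E
  have := isOrderedAddMonoid_of_covariantClass D
  have := isOrderedAddMonoid_of_covariantClass Z
  rcases J.eq_empty_or_nonempty with rfl | ⟨f₀, hf₀⟩
  · exact ⟨fun _ _ => ⟨by simp, by simp, by simp, 0, by simp⟩,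
      fun _ _ => ⟨0, fun _ _ => rfl, by simp⟩⟩
  let K : Submodule ℝ D :=
    { carrier := J
      add_mem' := fun {f g} hf hg => hJadd f hf g hg
      zero_mem' := by simpa using hJsmul 0 f₀ hf₀
      smul_mem' := hJsmul }
  have hm' : ∀ F f x, pE (m F f) x = F (centerFunctional hD hZ f x) := fun F f x =>
    hm F f x _ fun _ => rfl
  obtain ⟨u, hu, hcyc⟩ := hcyc
  exact ⟨fun F _ => isCentralOn_arens (J := K) hD hZ hJsolid hm' F, fun S hS =>
    exists_arens_eq_of_isCentralOn (J := K) hD hZ hJsolid hJsep hAlat hu hcyc hm' hS⟩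
end
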